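/- arXiv:math/0702646 — 11 statements merged into one kernel-verified Lean document; each statement's English description precedes it below -/
import Mathlib

section
/- Let G be a group such that (i) every infinite cyclic subgroup C of G has finite index [C_G(C) : C] in its centralizer C_G(C), and (ii) every ascending chain H_1 ⊆ H_2 ⊆ H_3 ⊆ … of finite subgroups of G is eventually stationary. Then every infinite virtually cyclic subgroup V of G is contained in a unique maximal infinite virtually cyclic subgroup: there exists a subgroup M of G that is infinite and virtually cyclic, contains V, and satisfies M = K for every infinite virtually cyclic subgroup K of G with M ⊆ K; moreover any two subgroups M with these three properties coincide. -/
/-- A group is virtually cyclic if it contains a cyclic subgroup of finite index. -/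
def IsVirtuallyCyclic (H : Type*) [Group H] : Prop :=
  ∃ C : Subgroup H, IsCyclic C ∧ C.FiniteIndex

open scoped Nat commutatorElement

/-- The subgroup of elements conjugating `x` to `x` or to `x⁻¹`. -/
def conjSelfOrInv {G : Type*} [Group G] (x : G) : Subgroup G where
  carrier := {g | g * x * g⁻¹ = x ∨ g * x * g⁻¹ = x⁻¹}
  one_mem' := by simp
  mul_mem' := by
    intro a b ha hb
    have key : a * b * x * (a * b)⁻¹ = a * (b * x * b⁻¹) * a⁻¹ := by group
    have hinv : a * x⁻¹ * a⁻¹ = (a * x * a⁻¹)⁻¹ := by group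
    simp only [Set.mem_ofPred_eq] at *
    rw [key]
    rcases hb with hb | hb <;> rcases ha with ha | ha <;> simp [hb, ha, hinv]
  inv_mem' := by
    intro a ha
    simp only [Set.mem_ofPred_eq, inv_inv] at *
    rcases ha with ha | ha
    · left
      nth_rw 1 [← ha]
      group
    · right
      have : (a⁻¹ * x * a)⁻¹ = a⁻¹ * x⁻¹ * a := by group
      rw [← inv_inj, inv_inv, this, ← ha]
      group

theorem mem_conjSelfOrInv {G : Type*} [Group G] {x g : G} :
    g ∈ conjSelfOrInv x ↔ g * x * g⁻¹ = x ∨ g * x * g⁻¹ = x⁻¹ := Iff.rfl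

theorem conj_zpow_eq_of_conj_eq {G : Type*} [Group G] {x y g : G} (h : g * x * g⁻¹ = y) (k : ℤ) :
    g * x ^ k * g⁻¹ = y ^ k := by
  rw [← h, conj_zpow]

theorem conjSelfOrInv_le_zpow {G : Type*} [Group G] (x : G) (k : ℤ) :
    conjSelfOrInv x ≤ conjSelfOrInv (x ^ k) := by
  rintro g (h | h)
  · exact Or.inl (conj_zpow_eq_of_conj_eq h k)
  · exact Or.inr (by rw [conj_zpow_eq_of_conj_eq h k, inv_zpow])

/-- Elements normalizing an infinite cyclic subgroup fix or invert each of its elements. -/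
theorem mem_conjSelfOrInv_of_normalizes {G : Type*} [Group G] {e g : G}
    (he : ¬ IsOfFinOrder e) (h₁ : g * e * g⁻¹ ∈ Subgroup.zpowers e)
    (h₂ : g⁻¹ * e * g ∈ Subgroup.zpowers e) : g ∈ conjSelfOrInv e := by
  obtain ⟨q, hq⟩ := h₁
  obtain ⟨r, hr⟩ := h₂
  simp only at hq hr
  have h : e ^ (q * r) = e ^ (1 : ℤ) := by
    have h' : e ^ (r * q) = g * (e ^ r) * g⁻¹ := by
      rw [← conj_zpow, ← hq, ← zpow_mul, mul_comm]
    rw [mul_comm, h', hr]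
    group
  have hqr : q * r = 1 := injective_zpow_iff_not_isOfFinOrder.2 he h
  rcases Int.eq_one_or_neg_one_of_mul_eq_one hqr with rfl | rfl
  · left; simpa using hq.symm
  · right; simpa using hq.symm

theorem finite_commutator_of_finiteIndex_center {G : Type*} [Group G]
    [(Subgroup.center G).FiniteIndex] : Finite (commutator G) := by
  have : Finite (commutatorSet G) := by
    refine Set.Finite.subset (Set.finite_range
      fun p : (G ⧸ Subgroup.center G) × (G ⧸ Subgroup.center G) ↦ ⁅p.1.out, p.2.out⁆) ?_
    rintro _ ⟨a, b, rfl⟩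
    refine ⟨(a, b), ?_⟩
    obtain ⟨⟨z, hz⟩, hz'⟩ := QuotientGroup.mk_out_eq_mul (Subgroup.center G) a
    obtain ⟨⟨w, hw⟩, hw'⟩ := QuotientGroup.mk_out_eq_mul (Subgroup.center G) b
    simp only [hz', hw', commutatorElement_def, mul_inv_rev]
    rw [Subgroup.mem_center_iff] at hz hw
    calc a * z * (b * w) * (z⁻¹ * a⁻¹) * (w⁻¹ * b⁻¹)
        = a * (z * (b * w * z⁻¹)) * a⁻¹ * w⁻¹ * b⁻¹ := by group
      _ = a * b * (w * a⁻¹) * w⁻¹ * b⁻¹ := by rw [← hz]; group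
      _ = a * b * a⁻¹ * b⁻¹ := by rw [← hw]; group
  infer_instance

/-- If `⟨x⟩` has finite index in its centralizer, then the centralizer of `x` has finite
derived subgroup. -/
theorem finite_commutator_centralizer {G : Type*} [Group G] (x : G)
    (h : ((Subgroup.zpowers x).subgroupOf (Subgroup.centralizer {x})).FiniteIndex) :
    Finite (⁅Subgroup.centralizer {x}, Subgroup.centralizer {x}⁆ : Subgroup G) := by
  have : (Subgroup.center (Subgroup.centralizer {x})).FiniteIndex := by
    refine Subgroup.finiteIndex_of_le (H := (Subgroup.zpowers x).subgroupOf _) ?_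
    rintro ⟨y, hy⟩ hyx
    obtain ⟨k, rfl⟩ := Subgroup.mem_zpowers_iff.1 (Subgroup.mem_subgroupOf.1 hyx)
    rw [Subgroup.mem_center_iff]
    rintro ⟨z, hz⟩
    have hz : Commute z x := Subgroup.mem_centralizer_singleton_iff.1 hz
    exact Subtype.ext (hz.zpow_right k)
  have := finite_commutator_of_finiteIndex_center (G := Subgroup.centralizer {x})
  rw [← Subgroup.map_subtype_commutator]
  exact Set.Finite.image _ (Set.toFinite _)

theorem relIndex_centralizer_ne_zero {G : Type*} [Group G] (N : Subgroup G) (c : G)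
    (h : ((fun g ↦ g * c * g⁻¹) '' (N : Set G)).Finite) :
    (Subgroup.centralizer {c}).relIndex N ≠ 0 := by
  have := h.to_subtype
  let f : N ⧸ (Subgroup.centralizer {c}).subgroupOf N → (fun g ↦ g * c * g⁻¹) '' (N : Set G) :=
    fun q ↦ ⟨_, q.out, q.out.2, rfl⟩
  have hf : Function.Injective f := by
    intro p q hpq
    have hpq : (p.out : G) * c * (p.out : G)⁻¹ = q.out * c * (q.out : G)⁻¹ :=
      congrArg Subtype.val hpq
    rw [← p.out_eq', ← q.out_eq']
    refine QuotientGroup.eq.2 (Subgroup.mem_subgroupOf.2 ?_)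
    rw [Subgroup.mem_centralizer_singleton_iff]
    simp only [Subgroup.coe_mul, Subgroup.coe_inv]
    generalize (p.out : G) = a at *
    generalize (q.out : G) = b at *
    calc _ = a⁻¹ * (b * c * b⁻¹) * b := by group
      _ = _ := by rw [← hpq]; group
  have := Finite.of_injective f hf
  exact Subgroup.index_ne_zero_of_finite

theorem monotone_conjSelfOrInv_factorial {G : Type*} [Group G] (c : G) :
    Monotone fun n : ℕ ↦ conjSelfOrInv (c ^ n !) := by
  intro m n hmn
  obtain ⟨k, hk⟩ := Nat.factorial_dvd_factorial hmn
  simpa [hk, pow_mul] using conjSelfOrInv_le_zpow (c ^ m !) k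

theorem monotone_centralizer_factorial {G : Type*} [Group G] (c : G) :
    Monotone fun n : ℕ ↦ Subgroup.centralizer {c ^ n !} := by
  intro m n hmn g hg
  obtain ⟨k, hk⟩ := Nat.factorial_dvd_factorial hmn
  rw [Subgroup.mem_centralizer_singleton_iff] at *
  rw [hk, pow_mul]
  exact (show Commute g (c ^ m !) from hg).pow_right k

/-- The elements `g` with `g * c ^ n * g⁻¹ = c ^ (± n)` for some `n ≠ 0`. -/
def virtualNormalizer {G : Type*} [Group G] (c : G) : Subgroup G :=
  ⨆ n : ℕ, conjSelfOrInv (c ^ n !)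

theorem mem_virtualNormalizer {G : Type*} [Group G] {c g : G} :
    g ∈ virtualNormalizer c ↔ ∃ n : ℕ, g ∈ conjSelfOrInv (c ^ n !) :=
  Subgroup.mem_iSup_of_directed (monotone_conjSelfOrInv_factorial c).directed_le

theorem mem_virtualNormalizer_of_pow {G : Type*} [Group G] {c g : G} {n : ℕ} (hn : n ≠ 0)
    (h : g ∈ conjSelfOrInv (c ^ n)) : g ∈ virtualNormalizer c := by
  obtain ⟨k, hk⟩ := Nat.dvd_factorial (Nat.pos_of_ne_zero hn) le_rfl
  refine mem_virtualNormalizer.2 ⟨n, ?_⟩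
  rw [hk, pow_mul]
  simpa using conjSelfOrInv_le_zpow (c ^ n) k h

theorem le_virtualNormalizer {G : Type*} [Group G] {c : G} (hc : ¬ IsOfFinOrder c)
    {K : Subgroup G} (hK : IsVirtuallyCyclic K) (hcK : c ∈ K) : K ≤ virtualNormalizer c := by
  obtain ⟨D, hD, hDi⟩ := hK
  have hle := Subgroup.normalCore_le D
  obtain ⟨e, he⟩ : ∃ e : K, Subgroup.zpowers e = D.normalCore := by
    have : IsCyclic D.normalCore :=
      isCyclic_of_injective (Subgroup.inclusion hle) (Subgroup.inclusion_injective hle)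
    exact (Subgroup.isCyclic_iff_exists_zpowers_eq_top _).1 this
  have hnormal : (Subgroup.zpowers e).Normal := he ▸ D.normalCore_normal
  have hidx : (Subgroup.zpowers e).index ≠ 0 := he ▸ Subgroup.FiniteIndex.index_ne_zero
  obtain ⟨m, hm, -, hmc⟩ := Subgroup.exists_pow_mem_of_index_ne_zero hidx (⟨c, hcK⟩ : K)
  obtain ⟨j, hj⟩ := Subgroup.mem_zpowers_iff.1 hmc
  have hcj : (e : G) ^ j = c ^ m := by simpa using congrArg Subtype.val hj
  have heo : ¬ IsOfFinOrder e := by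
    intro h
    refine hc (IsOfFinOrder.of_pow (n := m) ?_ hm.ne')
    rw [← hcj]
    exact (Submonoid.isOfFinOrder_coe.2 h).zpow
  intro g hg
  have hmem : (⟨g, hg⟩ : K) ∈ conjSelfOrInv e :=
    mem_conjSelfOrInv_of_normalizes heo (hnormal.conj_mem e (Subgroup.mem_zpowers e) _)
      (by simpa using hnormal.conj_mem e (Subgroup.mem_zpowers e) (⟨g, hg⟩ : K)⁻¹)
  have hmem : g ∈ conjSelfOrInv (e : G) := hmem.imp (congrArg Subtype.val) (congrArg Subtype.val)
  refine mem_virtualNormalizer_of_pow hm.ne' ?_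
  rw [← hcj]
  exact conjSelfOrInv_le_zpow _ j hmem

theorem finite_conj_virtualNormalizer {G : Type*} [Group G] {c : G} {D : Set G} (hD : D.Finite)
    (h : ∀ n : ℕ, ∀ g ∈ Subgroup.centralizer {c ^ n !}, ⁅g, c⁆ ∈ D) :
    ((fun g ↦ g * c * g⁻¹) '' (virtualNormalizer c : Set G)).Finite := by
  have hcent : ∀ n : ℕ, ∀ g, g * c ^ n ! * g⁻¹ = c ^ n ! → g * c * g⁻¹ ∈ (· * c) '' D :=
    fun n g hg ↦ ⟨⁅g, c⁆, h n g (Subgroup.mem_centralizer_singleton_iff.2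
      (mul_inv_eq_iff_eq_mul.1 hg)), by simp [commutatorElement_def]⟩
  by_cases hflip : ∃ m : ℕ, ∃ t : G, t * c ^ m ! * t⁻¹ = (c ^ m !)⁻¹
  · obtain ⟨m, t, ht⟩ := hflip
    refine ((hD.image (· * c)).union ((hD.image (· * c)).image fun y ↦ t⁻¹ * y * t)).subset ?_
    rintro _ ⟨g, hg, rfl⟩
    obtain ⟨n, hg | hg⟩ := mem_virtualNormalizer.1 hg
    · exact Or.inl (hcent n g hg)
    · refine Or.inr ⟨t * g * c * (t * g)⁻¹, hcent (max m n) (t * g) ?_, by group⟩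
      obtain ⟨k, hk⟩ := Nat.factorial_dvd_factorial (le_max_left m n)
      obtain ⟨l, hl⟩ := Nat.factorial_dvd_factorial (le_max_right m n)
      have h₁ : t * c ^ (max m n)! * t⁻¹ = (c ^ (max m n)!)⁻¹ := by
        rw [hk, pow_mul, ← conj_pow, ht, inv_pow]
      have h₂ : g * c ^ (max m n)! * g⁻¹ = (c ^ (max m n)!)⁻¹ := by
        rw [hl, pow_mul, ← conj_pow, hg, inv_pow]
      calc t * g * c ^ (max m n)! * (t * g)⁻¹ = t * (g * c ^ (max m n)! * g⁻¹) * t⁻¹ := by group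
        _ = (t * c ^ (max m n)! * t⁻¹)⁻¹ := by rw [h₂]; group
        _ = _ := by rw [h₁, inv_inv]
  · refine (hD.image (· * c)).subset ?_
    rintro _ ⟨g, hg, rfl⟩
    obtain ⟨n, hg | hg⟩ := mem_virtualNormalizer.1 hg
    · exact hcent n g hg
    · exact (hflip ⟨n, g, hg⟩).elim

theorem isVirtuallyCyclic_virtualNormalizer {G : Type*} [Group G]
    (hcent : ∀ C : Subgroup G, IsCyclic C → Infinite C →
      (C.subgroupOf (Subgroup.centralizer (C : Set G))).FiniteIndex)
    (hchain : ∀ H : ℕ → Subgroup G, Monotone H → (∀ n, Finite (H n)) →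
      ∃ n₀, ∀ n, n₀ ≤ n → H n = H n₀) {c : G} (hc : ¬ IsOfFinOrder c) :
    IsVirtuallyCyclic (virtualNormalizer c) := by
  have hcent' : ∀ x : G, ¬ IsOfFinOrder x →
      ((Subgroup.zpowers x).subgroupOf (Subgroup.centralizer {x})).FiniteIndex := by
    intro x hx
    have h := hcent (Subgroup.zpowers x) inferInstance
      (Set.infinite_coe_iff.2 (infinite_zpowers.2 hx))
    rwa [Subgroup.zpowers_eq_closure, Subgroup.centralizer_closure,
      ← Subgroup.zpowers_eq_closure] at h
  let Z : ℕ → Subgroup G := fun n ↦ Subgroup.centralizer {c ^ n !}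
  have hZ : Monotone Z := monotone_centralizer_factorial c
  have hfin : ∀ n, Finite (⁅Z n, Z n⁆ : Subgroup G) := fun n ↦
    finite_commutator_centralizer _ (hcent' _ fun h ↦ hc (h.of_pow n.factorial_ne_zero))
  have hmono : Monotone fun n ↦ ⁅Z n, Z n⁆ :=
    fun m n hmn ↦ Subgroup.commutator_mono (hZ hmn) (hZ hmn)
  obtain ⟨n₀, hn₀⟩ := hchain _ hmono hfin
  have hconj := finite_conj_virtualNormalizer (c := c) (D := (⁅Z n₀, Z n₀⁆ : Subgroup G))
    (Set.toFinite _) fun n g hg ↦ by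
      have hgc : ⁅g, c⁆ ∈ ⁅Z n, Z n⁆ := Subgroup.commutator_mem_commutator hg
        (Subgroup.mem_centralizer_singleton_iff.2 ((Commute.refl c).pow_right _))
      have := hmono (le_max_right n₀ n) hgc
      exact hn₀ _ (le_max_left n₀ n) ▸ this
  have h₁ : (Subgroup.zpowers c).relIndex (Subgroup.centralizer {c}) ≠ 0 :=
    (hcent' c hc).index_ne_zero
  have h₂ := relIndex_centralizer_ne_zero _ c hconj
  refine ⟨(Subgroup.zpowers c).subgroupOf _, ?_, ⟨Subgroup.relIndex_ne_zero_trans h₁ h₂⟩⟩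
  have hle : Subgroup.zpowers c ≤ virtualNormalizer c := by
    rw [Subgroup.zpowers_le]
    exact mem_virtualNormalizer.2 ⟨0, Or.inl (by simp)⟩
  exact (Subgroup.subgroupOfEquivOfLe hle).isCyclic.2 inferInstance

theorem unique_maximal_infinite_virtually_cyclic
    (G : Type*) [Group G]
    (hcent : ∀ C : Subgroup G, IsCyclic C → Infinite C →
      (C.subgroupOf (Subgroup.centralizer (C : Set G))).FiniteIndex)
    (hchain : ∀ H : ℕ → Subgroup G, Monotone H → (∀ n, Finite (H n)) →
      ∃ n₀, ∀ n, n₀ ≤ n → H n = H n₀) :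
    ∀ V : Subgroup G, Infinite V → IsVirtuallyCyclic V →
      ∃! M : Subgroup G, Infinite M ∧ IsVirtuallyCyclic M ∧ V ≤ M ∧
        ∀ K : Subgroup G, Infinite K → IsVirtuallyCyclic K → M ≤ K → M = K := by
  intro V hV hVc
  obtain ⟨c, hcV, hc⟩ : ∃ c ∈ V, ¬ IsOfFinOrder c := by
    obtain ⟨C, hC, hCi⟩ := hVc
    have : Infinite C := by
      by_contra h
      rw [not_infinite_iff_finite] at h
      exact hV.not_finite ((Subgroup.finite_iff_finite_and_finiteIndex C).2 ⟨h, hCi⟩)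
    obtain ⟨c, hc⟩ := IsCyclic.exists_generator (α := C)
    refine ⟨c, c.1.2, fun h ↦ ?_⟩
    have h : IsOfFinOrder c := Submonoid.isOfFinOrder_coe.1 (Submonoid.isOfFinOrder_coe.1 h)
    have : (Set.univ : Set C) ⊆ Subgroup.zpowers c := fun x _ ↦ hc x
    exact Set.infinite_univ ((finite_zpowers.2 h).subset this)
  have hVN := le_virtualNormalizer hc hVc hcV
  have hN := isVirtuallyCyclic_virtualNormalizer hcent hchain hc
  have hNinf : Infinite (virtualNormalizer c) :=
    Infinite.of_injective _ (Subgroup.inclusion_injective hVN)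
  refine ⟨virtualNormalizer c, ⟨hNinf, hN, hVN, fun K _ hK hle ↦
    le_antisymm hle (le_virtualNormalizer hc hK (hle (hVN hcV)))⟩, ?_⟩
  rintro M ⟨-, hM, hVM, hmax⟩
  exact hmax _ hNinf hN (le_virtualNormalizer hc hM (hVM hcV))
end

section
/- Let G be a group with the property that every subgroup of G that is not virtually cyclic contains a subgroup isomorphic to the free group of rank 2 (the free product ℤ ∗ ℤ). Then (i) every infinite cyclic subgroup C of G has finite index [C_G(C) : C] in its centralizer C_G(C), and (ii) every ascending chain H_1 ⊆ H_2 ⊆ H_3 ⊆ … of finite subgroups of G is eventually stationary. -/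
theorem Subgroup.relIndex_zpowers_zpow_ne_zero {G : Type*} [Group G] (g : G) {m : ℤ} (hm : m ≠ 0) :
    (Subgroup.zpowers (g ^ m)).relIndex (Subgroup.zpowers g) ≠ 0 := by
  have h1 : (Subgroup.zpowers (Multiplicative.ofAdd m)).map (zpowersHom G g) =
      Subgroup.zpowers (g ^ m) := by
    rw [MonoidHom.map_zpowers]
    simp
  have h2 : (⊤ : Subgroup (Multiplicative ℤ)).map (zpowersHom G g) = Subgroup.zpowers g := by
    rw [← MonoidHom.range_eq_map]
    ext x
    simp [Subgroup.mem_zpowers_iff, MonoidHom.mem_range, Multiplicative.exists]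
  have h3 : (Subgroup.zpowers (Multiplicative.ofAdd m)).index ≠ 0 := by
    have h := Int.index_zmultiples m
    rw [← AddSubgroup.index_toSubgroup] at h
    change (AddSubgroup.toSubgroup (AddSubgroup.zmultiples m)).index ≠ 0
    rw [h]
    exact Int.natAbs_ne_zero.mpr hm
  rw [← h1, ← h2, Subgroup.relIndex_map_map, top_sup_eq, Subgroup.relIndex_top_right]
  intro h
  exact h3 (Nat.eq_zero_of_zero_dvd (h ▸ Subgroup.index_dvd_of_le le_sup_left))

theorem IsVirtuallyCyclic.index_zpowers_ne_zero {H : Type*} [Group H] (hH : IsVirtuallyCyclic H)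
    (c : H) (hc : ∀ n : ℕ, 0 < n → c ^ n ≠ 1) : (Subgroup.zpowers c).index ≠ 0 := by
  obtain ⟨D, hD, hfin⟩ := hH
  obtain ⟨d, rfl⟩ := (Subgroup.isCyclic_iff_exists_zpowers_eq_top D).mp hD
  obtain ⟨n, hn, -, hcn⟩ := Subgroup.exists_pow_mem_of_index_ne_zero hfin.index_ne_zero c
  obtain ⟨m, hm⟩ := Subgroup.mem_zpowers_iff.mp hcn
  have hm0 : m ≠ 0 := by
    rintro rfl
    exact hc n hn (by simpa using hm.symm)
  have hle : Subgroup.zpowers (d ^ m) ≤ Subgroup.zpowers d := by simp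
  have hle' : Subgroup.zpowers (d ^ m) ≤ Subgroup.zpowers c := by simp [hm]
  have h := mul_ne_zero (Subgroup.relIndex_zpowers_zpow_ne_zero d hm0) hfin.index_ne_zero
  rw [Subgroup.relIndex_mul_index hle] at h
  intro h0
  exact h (Nat.eq_zero_of_zero_dvd (h0 ▸ Subgroup.index_dvd_of_le hle'))

theorem FreeGroup.not_commute_of_zero_pow_of_one {n : ℕ} (hn : 0 < n) :
    ¬ Commute ((FreeGroup.of (0 : Fin 2)) ^ n) (FreeGroup.of (1 : Fin 2)) := by
  intro h
  have h' := h.map (FreeGroup.lift ![ModularGroup.T, ModularGroup.S])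
  simp only [map_pow, FreeGroup.lift_apply_of, Matrix.cons_val_zero, Matrix.cons_val_one] at h'
  have h2 : ((ModularGroup.T ^ n * ModularGroup.S : Matrix.SpecialLinearGroup (Fin 2) ℤ) :
      Matrix (Fin 2) (Fin 2) ℤ) 0 0 = ((ModularGroup.S * ModularGroup.T ^ n :
      Matrix.SpecialLinearGroup (Fin 2) ℤ) : Matrix (Fin 2) (Fin 2) ℤ) 0 0 := by rw [h'.eq]
  rw [← zpow_natCast, Matrix.SpecialLinearGroup.coe_mul, Matrix.SpecialLinearGroup.coe_mul,
    ModularGroup.coe_T_zpow] at h2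
  simp [ModularGroup.S] at h2
  omega

theorem FreeGroup.of_pow_ne_one {n : ℕ} (hn : 0 < n) : (FreeGroup.of (0 : Fin 2)) ^ n ≠ 1 :=
  fun h => FreeGroup.not_commute_of_zero_pow_of_one hn (h ▸ Commute.one_left _)

theorem conditions_of_free_subgroup_property
    (G : Type*) [Group G]
    (hfree : ∀ H : Subgroup G, ¬ IsVirtuallyCyclic H →
      ∃ f : FreeGroup (Fin 2) →* G, Function.Injective f ∧ ∀ x, f x ∈ H) :
    (∀ C : Subgroup G, IsCyclic C → Infinite C →
      (C.subgroupOf (Subgroup.centralizer (C : Set G))).FiniteIndex) ∧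
    (∀ H : ℕ → Subgroup G, Monotone H → (∀ n, Finite (H n)) →
      ∃ n₀, ∀ n, n₀ ≤ n → H n = H n₀) := by
  constructor
  · intro C hC hinf
    obtain ⟨c, rfl⟩ := (Subgroup.isCyclic_iff_exists_zpowers_eq_top C).mp hC
    have hc : ∀ n : ℕ, 0 < n → c ^ n ≠ 1 := by
      intro n hn h
      exact Set.infinite_coe_iff.mp hinf (isOfFinOrder_iff_pow_eq_one.mpr ⟨n, hn, h⟩).finite_zpowers
    set Z := Subgroup.centralizer (Subgroup.zpowers c : Set G) with hZ
    have hcZ : c ∈ Z := by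
      rw [hZ, Subgroup.mem_centralizer_iff]
      rintro _ ⟨k, rfl⟩
      exact (Commute.refl c).zpow_left k
    by_cases hv : IsVirtuallyCyclic Z
    · have h := hv.index_zpowers_ne_zero ⟨c, hcZ⟩ fun n hn h => hc n hn (congrArg Subtype.val h)
      have hle : Subgroup.zpowers (⟨c, hcZ⟩ : Z) ≤ (Subgroup.zpowers c).subgroupOf Z := by
        rw [Subgroup.zpowers_le, Subgroup.mem_subgroupOf]
        exact Subgroup.mem_zpowers c
      exact ⟨fun h0 => h (Nat.eq_zero_of_zero_dvd (h0 ▸ Subgroup.index_dvd_of_le hle))⟩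
    · exfalso
      obtain ⟨f, hf, hfZ⟩ := hfree Z hv
      have hcomm : ∀ x, Commute c (f x) := fun x =>
        Subgroup.mem_centralizer_iff.mp (hfZ x) c (Subgroup.mem_zpowers c)
      set a := f (FreeGroup.of 0)
      let A := Subgroup.closure {c, a}
      have hA : IsMulCommutative A := by
        apply Subgroup.isMulCommutative_closure
        have := (hcomm (FreeGroup.of 0)).eq
        rintro x (rfl | rfl) y (rfl | rfl)
        exacts [rfl, this, this.symm, rfl]
      have hcA : c ∈ A := Subgroup.subset_closure (by simp)
      have haA : a ∈ A := Subgroup.subset_closure (by simp)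
      by_cases hvA : IsVirtuallyCyclic A
      · have h := hvA.index_zpowers_ne_zero ⟨c, hcA⟩ fun n hn h => hc n hn (congrArg Subtype.val h)
        obtain ⟨n, hn, -, k, hk⟩ := Subgroup.exists_pow_mem_of_index_ne_zero h ⟨a, haA⟩
        have hk' : c ^ k = a ^ n := congrArg Subtype.val hk
        apply FreeGroup.not_commute_of_zero_pow_of_one hn
        apply hf
        rw [map_mul, map_mul, map_pow]
        change a ^ n * _ = _ * a ^ n
        rw [← hk']
        exact (hcomm _).zpow_left k
      · obtain ⟨g, hg, hgA⟩ := hfree A hvA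
        apply FreeGroup.not_commute_of_zero_pow_of_one one_pos
        apply hg
        rw [map_mul, map_mul]
        exact congrArg Subtype.val (mul_comm' (⟨_, hgA _⟩ : A) ⟨_, hgA _⟩)
  · intro H hmono hfin
    have hmem : ∀ x, x ∈ (⨆ n, H n) ↔ ∃ n, x ∈ H n := fun x =>
      Subgroup.mem_iSup_of_directed hmono.directed_le
    have htors : ∀ x ∈ (⨆ n, H n), ∃ k : ℕ, 0 < k ∧ x ^ k = 1 := by
      intro x hx
      obtain ⟨n, hn⟩ := (hmem x).mp hx
      obtain ⟨k, hk, h⟩ := isOfFinOrder_iff_pow_eq_one.mp (isOfFinOrder_of_finite (⟨x, hn⟩ : H n))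
      exact ⟨k, hk, congrArg Subtype.val h⟩
    have hU : Finite (⨆ n, H n : Subgroup G) := by
      by_cases hv : IsVirtuallyCyclic (⨆ n, H n : Subgroup G)
      · obtain ⟨D, hD, hDfin⟩ := hv
        obtain ⟨d, rfl⟩ := (Subgroup.isCyclic_iff_exists_zpowers_eq_top D).mp hD
        obtain ⟨k, hk, h⟩ := htors d d.2
        have hd : Finite (Subgroup.zpowers d) :=
          (isOfFinOrder_iff_pow_eq_one.mpr ⟨k, hk, Subtype.ext h⟩).finite_zpowers
        exact (Subgroup.finite_iff_finite_and_finiteIndex _).mpr ⟨hd, hDfin⟩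
      · obtain ⟨f, hf, hfU⟩ := hfree _ hv
        obtain ⟨k, hk, h⟩ := htors _ (hfU (FreeGroup.of 0))
        exact absurd (hf (by rw [map_pow, h, map_one])) (FreeGroup.of_pow_ne_one hk)
    choose N hN using fun x : (⨆ n, H n : Subgroup G) => (hmem x).mp x.2
    obtain ⟨n₀, hn₀⟩ := (Set.finite_range N).bddAbove
    refine ⟨n₀, fun n hn => le_antisymm (fun x hx => ?_) (hmono hn)⟩
    exact hmono (hn₀ ⟨⟨x, (hmem x).mpr ⟨n, hx⟩⟩, rfl⟩) (hN _)
end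

section
/- Let G be the semidirect product ℤ ⋊ ℤ with respect to the homomorphism ℤ → Aut(ℤ) sending the generator to −id (equivalently, G has presentation ⟨s, t | s t s⁻¹ = t⁻¹⟩, with t generating the normal ℤ-factor and s generating the acting ℤ-factor). Then the cyclic subgroups ⟨s⟩ and ⟨s t⟩ generated by s and by s t are distinct, each is maximal among infinite virtually cyclic subgroups of G (each is infinite cyclic and any infinite virtually cyclic subgroup of G containing it equals it), and their intersection is the subgroup ⟨s²⟩ generated by s². In particular, the infinite cyclic subgroup ⟨s²⟩ is contained in two distinct maximal infinite virtually cyclic subgroups of G, so G does not satisfy the condition (M_{FIN ⊆ VCY}). -/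
/-- The homomorphism `ℤ → Aut(ℤ)` sending the generator to `-id`
(written multiplicatively). -/
def negAction : Multiplicative ℤ →* MulAut (Multiplicative ℤ) :=
  zpowersHom (MulAut (Multiplicative ℤ)) (MulEquiv.inv (Multiplicative ℤ))

/-- The semidirect product `ℤ ⋊ ℤ` with respect to the `-id` action. -/
abbrev ZSemidirectZ : Type :=
  SemidirectProduct (Multiplicative ℤ) (Multiplicative ℤ) negAction

/-- The generator `t` of the normal `ℤ`-factor. -/
def tGen : ZSemidirectZ := SemidirectProduct.inl (Multiplicative.ofAdd 1)

/-- The generator `s` of the acting `ℤ`-factor. -/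
def sGen : ZSemidirectZ := SemidirectProduct.inr (Multiplicative.ofAdd 1)

theorem right_zpow_of_right_eq {u : ZSemidirectZ} (hu : u.right = Multiplicative.ofAdd 1)
    (n : ℤ) : (u ^ n).right = Multiplicative.ofAdd n := by
  have h : (SemidirectProduct.rightHom (u ^ n) : Multiplicative ℤ)
      = (SemidirectProduct.rightHom u) ^ n := map_zpow _ _ _
  simpa [hu, ← ofAdd_zsmul] using h

theorem zpow_injective_of_right_eq {u : ZSemidirectZ} (hu : u.right = Multiplicative.ofAdd 1) :
    Function.Injective (fun n : ℤ => u ^ n) := by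
  intro m n h
  have := congrArg SemidirectProduct.right h
  simpa [right_zpow_of_right_eq hu] using this

theorem infinite_zpowers_of_right_eq {u : ZSemidirectZ} (hu : u.right = Multiplicative.ofAdd 1) :
    Infinite (Subgroup.zpowers u) :=
  Infinite.of_injective (fun n : ℤ => (⟨u ^ n, n, rfl⟩ : Subgroup.zpowers u))
    fun _ _ h => zpow_injective_of_right_eq hu (congrArg Subtype.val h)

theorem IsVirtuallyCyclic.of_isCyclic (H : Type*) [Group H] [IsCyclic H] : IsVirtuallyCyclic H :=
  ⟨⊤, inferInstance, inferInstance⟩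

/-- In a virtually cyclic group any two elements have positive powers in a common cyclic
subgroup. -/
theorem IsVirtuallyCyclic.exists_pow_eq_zpow {H : Type*} [Group H] (hH : IsVirtuallyCyclic H)
    (x y : H) : ∃ (c : H) (k l : ℕ) (p q : ℤ), 0 < k ∧ 0 < l ∧ x ^ k = c ^ p ∧ y ^ l = c ^ q := by
  obtain ⟨C, hC, hfin⟩ := hH
  obtain ⟨c, hc⟩ := (Subgroup.isCyclic_iff_exists_zpowers_eq_top C).mp hC
  obtain ⟨k, hk, -, hxk⟩ := Subgroup.exists_pow_mem_of_index_ne_zero hfin.index_ne_zero x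
  obtain ⟨l, hl, -, hyl⟩ := Subgroup.exists_pow_mem_of_index_ne_zero hfin.index_ne_zero y
  rw [← hc] at hxk hyl
  obtain ⟨p, hp⟩ := hxk
  obtain ⟨q, hq⟩ := hyl
  exact ⟨c, k, l, p, q, hk, hl, hp.symm, hq.symm⟩

/-- A virtually cyclic subgroup containing an element that projects to the acting generator
meets the normal factor trivially. -/
theorem eq_one_of_right_eq_one {u : ZSemidirectZ} (hu : u.right = Multiplicative.ofAdd 1)
    {K : Subgroup ZSemidirectZ} (hK : IsVirtuallyCyclic K) (huK : u ∈ K)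
    {g : ZSemidirectZ} (hgK : g ∈ K) (hg : g.right = 1) : g = 1 := by
  obtain ⟨c, k, l, p, q, hk, hl, hp, hq⟩ := hK.exists_pow_eq_zpow ⟨g, hgK⟩ ⟨u, huK⟩
  have hp' : g ^ k = (c : ZSemidirectZ) ^ p := by simpa using congrArg Subtype.val hp
  have hq' : u ^ (l : ℤ) = (c : ZSemidirectZ) ^ q := by simpa using congrArg Subtype.val hq
  have hinl : g = SemidirectProduct.inl g.left := by ext <;> simp [hg]
  have h : (g ^ k) ^ q = u ^ ((l : ℤ) * p) := by
    rw [zpow_mul, hp', hq', ← zpow_mul, ← zpow_mul, mul_comm]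
  have hr := congrArg SemidirectProduct.right h
  rw [right_zpow_of_right_eq hu, hinl, ← map_pow, ← map_zpow, SemidirectProduct.right_inl] at hr
  have hlp : (l : ℤ) * p = 0 := (Multiplicative.ofAdd.injective hr).symm
  have hp0 : p = 0 := (mul_eq_zero.mp hlp).resolve_left (by omega)
  rw [hp0, zpow_zero, hinl, ← map_pow] at hp'
  have hleft : g.left ^ k = 1 := SemidirectProduct.inl_injective (by rw [hp', map_one])
  rw [hinl, (pow_eq_one_iff_left hk.ne').mp hleft, map_one]

theorem eq_zpowers_of_isVirtuallyCyclic {u : ZSemidirectZ}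
    (hu : u.right = Multiplicative.ofAdd 1) {K : Subgroup ZSemidirectZ}
    (hK : IsVirtuallyCyclic K) (huK : Subgroup.zpowers u ≤ K) : K = Subgroup.zpowers u := by
  refine le_antisymm (fun g hg => ?_) huK
  have hu' : u ∈ K := huK (Subgroup.mem_zpowers u)
  refine ⟨g.right.toAdd, (mul_inv_eq_one.mp (eq_one_of_right_eq_one hu hK hu'
    (K.mul_mem hg (K.inv_mem (K.zpow_mem hu' g.right.toAdd))) ?_)).symm⟩
  rw [SemidirectProduct.mul_right, SemidirectProduct.inv_right, right_zpow_of_right_eq hu]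
  simp

theorem sGen_right : sGen.right = Multiplicative.ofAdd 1 := rfl

theorem sGen_mul_tGen_right : (sGen * tGen).right = Multiplicative.ofAdd 1 := rfl

theorem sGen_mul_tGen_ne_sGen : sGen * tGen ≠ sGen := by
  rw [Ne, mul_eq_left, tGen, ← map_one SemidirectProduct.inl,
    SemidirectProduct.inl_injective.eq_iff]
  decide

theorem sGen_mul_tGen_sq : (sGen * tGen) ^ 2 = sGen ^ 2 := by
  rw [pow_two, pow_two]
  ext <;> rfl

theorem zpowers_sGen_ne : Subgroup.zpowers sGen ≠ Subgroup.zpowers (sGen * tGen) := by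
  intro h
  obtain ⟨n, hn⟩ : sGen * tGen ∈ Subgroup.zpowers sGen := h ▸ Subgroup.mem_zpowers _
  have hr := congrArg SemidirectProduct.right hn
  simp only [right_zpow_of_right_eq sGen_right, sGen_mul_tGen_right] at hr
  rw [Multiplicative.ofAdd.injective hr] at hn
  exact sGen_mul_tGen_ne_sGen (by simpa using hn.symm)

theorem zpowers_sGen_inf :
    Subgroup.zpowers sGen ⊓ Subgroup.zpowers (sGen * tGen) = Subgroup.zpowers (sGen ^ 2) := by
  apply le_antisymm
  · rintro g ⟨⟨m, rfl⟩, ⟨n, hn⟩⟩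
    have hr := congrArg SemidirectProduct.right hn
    simp only [right_zpow_of_right_eq sGen_right,
      right_zpow_of_right_eq sGen_mul_tGen_right] at hr
    obtain rfl : n = m := Multiplicative.ofAdd.injective hr
    have hsq (k : ℤ) : (sGen * tGen) ^ (2 * k) = sGen ^ (2 * k) := by
      simpa only [zpow_mul, zpow_ofNat] using congrArg (· ^ k) sGen_mul_tGen_sq
    obtain ⟨k, rfl | rfl⟩ := n.even_or_odd'
    · exact ⟨k, by simp only [zpow_mul, zpow_ofNat]⟩
    · simp only [zpow_add, zpow_one, hsq, mul_right_inj] at hn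
      exact absurd (hn) sGen_mul_tGen_ne_sGen
  · rw [Subgroup.zpowers_le]
    exact ⟨⟨2, zpow_ofNat _ _⟩, ⟨2, (zpow_ofNat _ _).trans sGen_mul_tGen_sq⟩⟩

theorem infinite_zpowers_sGen_sq : Infinite (Subgroup.zpowers (sGen ^ 2)) := by
  refine Infinite.of_injective
    (fun n : ℤ => (⟨(sGen ^ 2) ^ n, n, rfl⟩ : Subgroup.zpowers (sGen ^ 2))) fun m n h => ?_
  have h' : sGen ^ (2 * m) = sGen ^ (2 * n) := by
    simpa only [zpow_mul, zpow_ofNat] using congrArg Subtype.val h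
  have := zpow_injective_of_right_eq sGen_right h'
  omega

theorem zsemidirectz_not_M_FIN_VCY :
    (Subgroup.zpowers sGen ≠ Subgroup.zpowers (sGen * tGen)) ∧
    (Infinite (Subgroup.zpowers sGen) ∧
      ∀ K : Subgroup ZSemidirectZ, Infinite K → IsVirtuallyCyclic K →
        Subgroup.zpowers sGen ≤ K → K = Subgroup.zpowers sGen) ∧
    (Infinite (Subgroup.zpowers (sGen * tGen)) ∧
      ∀ K : Subgroup ZSemidirectZ, Infinite K → IsVirtuallyCyclic K →
        Subgroup.zpowers (sGen * tGen) ≤ K → K = Subgroup.zpowers (sGen * tGen)) ∧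
    (Subgroup.zpowers sGen ⊓ Subgroup.zpowers (sGen * tGen)
      = Subgroup.zpowers (sGen ^ 2)) ∧
    ¬ (∀ V : Subgroup ZSemidirectZ, Infinite V → IsVirtuallyCyclic V →
        ∃! M : Subgroup ZSemidirectZ, Infinite M ∧ IsVirtuallyCyclic M ∧ V ≤ M ∧
          ∀ K : Subgroup ZSemidirectZ, Infinite K → IsVirtuallyCyclic K → M ≤ K → M = K) := by
  refine ⟨zpowers_sGen_ne,
    ⟨infinite_zpowers_of_right_eq sGen_right,
      fun K _ hK hle => eq_zpowers_of_isVirtuallyCyclic sGen_right hK hle⟩,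
    ⟨infinite_zpowers_of_right_eq sGen_mul_tGen_right,
      fun K _ hK hle => eq_zpowers_of_isVirtuallyCyclic sGen_mul_tGen_right hK hle⟩,
    zpowers_sGen_inf, fun h => zpowers_sGen_ne ?_⟩
  have hle := zpowers_sGen_inf.ge
  refine (h (Subgroup.zpowers (sGen ^ 2)) infinite_zpowers_sGen_sq
    (IsVirtuallyCyclic.of_isCyclic _)).unique ?_ ?_
  · exact ⟨infinite_zpowers_of_right_eq sGen_right, IsVirtuallyCyclic.of_isCyclic _,
      hle.trans inf_le_left,
      fun K _ hK hK' => (eq_zpowers_of_isVirtuallyCyclic sGen_right hK hK').symm⟩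
  · exact ⟨infinite_zpowers_of_right_eq sGen_mul_tGen_right, IsVirtuallyCyclic.of_isCyclic _,
      hle.trans inf_le_right,
      fun K _ hK hK' => (eq_zpowers_of_isVirtuallyCyclic sGen_mul_tGen_right hK hK').symm⟩
end

section
/- Let G be a poly-ℤ group admitting a chain {1} = G_0 ⊆ G_1 ⊆ … ⊆ G_n = G of subgroups such that G_{i−1} is normal in G_i with infinite cyclic quotient G_i/G_{i−1} for i = 1, …, n. Then the n-th group cohomology H^n(G; ℤ) of G with coefficients in the trivial G-module ℤ is isomorphic, as an abelian group, either to ℤ or to ℤ/2ℤ. -/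
/-- A poly-ℤ chain of length `n` for a group `G`: a chain
`{1} = c 0 ⊆ c 1 ⊆ … ⊆ c n = G` of subgroups such that each `c i` is normal in
`c (i+1)` with infinite cyclic quotient (expressed by the existence of a surjection
of `c (i+1)` onto `ℤ` with kernel `c i`). -/
def IsPolyZChain {G : Type*} [Group G] {n : ℕ} (c : Fin (n + 1) → Subgroup G) : Prop :=
  c 0 = ⊥ ∧ c (Fin.last n) = ⊤ ∧
  ∀ i : Fin n, c i.castSucc ≤ c i.succ ∧
    ∃ f : (c i.succ) →* Multiplicative ℤ, Function.Surjective f ∧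
      f.ker = (c i.castSucc).subgroupOf (c i.succ)

open CategoryTheory

theorem exists_int_shift_sub_eq {A : Type*} [AddCommGroup A] (h : ℤ → A) :
    ∃ s : ℤ → A, ∀ k, s (k + 1) - s k = h k := by
  refine ⟨fun k ↦ ∑ i ∈ Finset.Ico 0 k, h i - ∑ i ∈ Finset.Ico k 0, h i, fun k ↦ ?_⟩
  rcases le_or_gt 0 k with hk | hk
  · have h₁ : Finset.Ico 0 (k + 1) = insert k (Finset.Ico 0 k) := by
      ext; simp; omega
    simp [h₁, Finset.Ico_eq_empty_of_le hk, Finset.Ico_eq_empty_of_le (by omega : 0 ≤ k + 1)]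
  · have h₁ : Finset.Ico k 0 = insert k (Finset.Ico (k + 1) 0) := by
      ext; simp; omega
    simp [h₁, Finset.Ico_eq_empty_of_le hk.le, Finset.Ico_eq_empty_of_le (by omega : k + 1 ≤ 0)]

/-- An abelian group is isomorphic to `ℤ` or to `ℤ/2ℤ`. -/
def IsIntOrZModTwo (A : Type*) [AddCommGroup A] : Prop :=
  Nonempty (A ≃+ ℤ) ∨ Nonempty (A ≃+ ZMod 2)

theorem IsIntOrZModTwo.congr {A B : Type*} [AddCommGroup A] [AddCommGroup B]
    (hA : IsIntOrZModTwo A) (e : A ≃+ B) : IsIntOrZModTwo B :=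
  hA.imp (fun ⟨f⟩ ↦ ⟨e.symm.trans f⟩) fun ⟨f⟩ ↦ ⟨e.symm.trans f⟩

/-- If `A` is `ℤ` or `ℤ/2ℤ`, then so is the cokernel of `τ - 1` for every automorphism `τ`
of `A`. -/
theorem IsIntOrZModTwo.of_surjective {A B : Type*} [AddCommGroup A] [AddCommGroup B]
    (hA : IsIntOrZModTwo A) (τ : A ≃+ A) (δ : A →+ B) (hδ : Function.Surjective δ)
    (hker : ∀ a, δ a = 0 ↔ ∃ b, τ b - b = a) : IsIntOrZModTwo B := by
  have of_id (h : ∀ a, τ a = a) : IsIntOrZModTwo B := by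
    refine hA.congr (AddEquiv.ofBijective δ ⟨(injective_iff_map_eq_zero δ).2 fun a ha ↦ ?_, hδ⟩)
    obtain ⟨b, rfl⟩ := (hker a).1 ha
    rw [h, sub_self]
  rcases hA with ⟨⟨e⟩⟩ | ⟨⟨e⟩⟩
  · have hτ (a : A) : e (τ a) = e a * e (τ (e.symm 1)) := by
      have : a = e a • e.symm 1 := e.injective (by simp)
      conv_lhs => rw [this, map_zsmul, map_zsmul, smul_eq_mul]
    have hu : IsUnit (e (τ (e.symm 1))) := by
      refine IsUnit.of_mul_eq_one_right (e (τ.symm (e.symm 1))) ?_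
      rw [← hτ]; simp
    rcases Int.isUnit_iff.1 hu with hu | hu <;> rw [hu] at hτ
    · exact of_id fun a ↦ e.injective (by simp [hτ])
    · right
      have hk : (δ.comp e.symm.toAddMonoidHom).ker = AddSubgroup.zmultiples ((2 : ℕ) : ℤ) := by
        ext z
        rw [AddMonoidHom.mem_ker, Int.mem_zmultiples_iff]
        simp only [AddMonoidHom.comp_apply, AddEquiv.coe_toAddMonoidHom, hker]
        constructor
        · rintro ⟨b, hb⟩
          have := congrArg e hb
          simp [hτ] at this
          exact ⟨-e b, by push_cast; omega⟩
        · rintro ⟨w, rfl⟩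
          refine ⟨e.symm (-w), e.injective ?_⟩
          simp [hτ]; ring
      exact ⟨((Int.quotientZMultiplesNatEquivZMod 2).symm.trans
        ((QuotientAddGroup.quotientAddEquivOfEq hk.symm).trans
        (QuotientAddGroup.quotientKerEquivOfSurjective _ (hδ.comp e.symm.surjective)))).symm⟩
  · refine of_id fun a ↦ ?_
    by_cases ha : a = 0
    · simp [ha]
    · have key : ∀ x y : ZMod 2, x ≠ 0 → y ≠ 0 → x = y := by decide
      exact e.injective (key _ _ (by simpa using ha) (by simpa using ha))

namespace groupCohomology

universe u

variable {k G : Type u} [CommRing k] [Group G] (f : G →* Multiplicative ℤ)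
  (V : Type u) [AddCommGroup V] [Module k V]

theorem map_id_sub {A B : Rep k G} (φ ψ : A ⟶ B) (n : ℕ) :
    map (MonoidHom.id G) (φ - ψ) n =
      map (MonoidHom.id G) φ n - map (MonoidHom.id G) ψ n :=
  HomologicalComplex.homologyMap_sub (cochainsMap (MonoidHom.id G) φ)
    (cochainsMap (MonoidHom.id G) ψ) n

/-- The representation of `G` coinduced from the trivial representation `V` of `f.ker`. -/
noncomputable abbrev coindKer : Rep k G :=
  Rep.coind f.ker.subtype (Rep.trivial k f.ker V)

theorem coindKer_apply_eq {F : G → V}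
    (hF : F ∈ Representation.coindV f.ker.subtype (Rep.trivial k f.ker V).ρ) {g h : G}
    (hgh : f g = f h) : F g = F h := by
  have := hF ⟨g * h⁻¹, by simp [MonoidHom.mem_ker, hgh]⟩ h
  simpa using this

/-- Left translation by `t`, as an endomorphism of the coinduced representation. -/
noncomputable def coindKerShift (t : G) : coindKer (k := k) f V ⟶ coindKer f V :=
  Rep.ofHom
    { toFun F := ⟨fun g ↦ F.1 (t * g), fun g h ↦ coindKer_apply_eq f V F.2 (by
        simp [MonoidHom.mem_ker.1 g.2])⟩
      map_add' _ _ := rfl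
      map_smul' _ _ := rfl
      isIntertwining' h := LinearMap.ext fun F ↦ Subtype.ext <| funext fun g ↦
        congrArg F.1 (mul_assoc t g h : t * g * h = t * (g * h)) }

/-- Translation by `t` is invertible, with inverse the translation by `t⁻¹`. -/
noncomputable def coindKerShiftIso (t : G) : coindKer (k := k) f V ≅ coindKer f V where
  hom := coindKerShift f V t
  inv := coindKerShift f V t⁻¹
  hom_inv_id := Rep.hom_ext <| Representation.IntertwiningMap.ext <| LinearMap.ext fun F ↦
    Subtype.ext <| funext fun g ↦ congrArg F.1 (mul_inv_cancel_left t g)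
  inv_hom_id := Rep.hom_ext <| Representation.IntertwiningMap.ext <| LinearMap.ext fun F ↦
    Subtype.ext <| funext fun g ↦ congrArg F.1 (inv_mul_cancel_left t g)

/-- The inclusion of the constant functions. -/
noncomputable def coindKerConst : Rep.trivial k G V ⟶ coindKer f V :=
  Rep.ofHom
    { toFun v := ⟨fun _ ↦ v, fun _ _ ↦ rfl⟩
      map_add' _ _ := rfl
      map_smul' _ _ := rfl
      isIntertwining' _ := rfl }

/-- The complex `V ⟶ coind V ⟶ coind V` whose second map is `F ↦ F (t * ·) - F`. -/
noncomputable def wangComplex (t : G) : ShortComplex (Rep k G) where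
  f := coindKerConst f V
  g := coindKerShift f V t - 𝟙 _
  zero := Rep.hom_ext <| Representation.IntertwiningMap.ext <| LinearMap.ext fun v ↦
    Subtype.ext <| funext fun _ ↦ sub_self v

theorem wangComplex_shortExact {t : G} (ht : f t = Multiplicative.ofAdd 1) :
    (wangComplex (k := k) f V t).ShortExact where
  exact := by
    refine (forget₂ (Rep k G) (ModuleCat k)).reflects_exact_of_faithful _ <|
      (ShortComplex.moduleCat_exact_iff _).2 fun (F : coindKer f V) hF ↦
        ⟨F.1 1, Subtype.ext <| funext fun g ↦ ?_⟩
    have hs (x : G) : F.1 (t * x) = F.1 x :=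
      sub_eq_zero.1 (congrFun (congrArg Subtype.val hF) x)
    have hz (n : ℤ) : F.1 (t ^ n) = F.1 1 := by
      induction n with
      | zero => simp
      | succ n ih => rw [← ih, add_comm, zpow_add, zpow_one, hs]
      | pred n ih => rw [← ih, ← hs, ← zpow_one_add, add_sub_cancel]
    change F.1 1 = F.1 g
    rw [← hz (f g).toAdd]
    exact coindKer_apply_eq f V F.2 (by simp [ht, ← ofAdd_zsmul])
  mono_f := (Rep.mono_iff_injective _).2 fun v w h ↦
    congrFun (congrArg Subtype.val h) 1
  epi_g := by
    refine (Rep.epi_iff_surjective _).2 fun (H : coindKer f V) ↦ ?_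
    obtain ⟨s, hs⟩ := exists_int_shift_sub_eq fun n ↦ H.1 (t ^ n)
    refine ⟨(⟨fun g ↦ s (f g).toAdd, fun g h ↦ ?_⟩ : coindKer f V),
      Subtype.ext <| funext fun g ↦ ?_⟩
    · simp [MonoidHom.mem_ker.1 g.2]
    · change s (f (t * g)).toAdd - s (f g).toAdd = H.1 g
      rw [map_mul, ht, toAdd_mul, toAdd_ofAdd, add_comm, hs]
      exact coindKer_apply_eq f V H.2 (by simp [ht, ← ofAdd_zsmul])

/-- The long exact sequence of an extension by an infinite cyclic group. -/
theorem exists_wang_sequence (hf : Function.Surjective f) (n : ℕ) :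
    ∃ (τ : groupCohomology (Rep.trivial k f.ker V) n ≃+
        groupCohomology (Rep.trivial k f.ker V) n)
      (δ : groupCohomology (Rep.trivial k f.ker V) n →+
        groupCohomology (Rep.trivial k G V) (n + 1))
      (r : groupCohomology (Rep.trivial k G V) (n + 1) →+
        groupCohomology (Rep.trivial k f.ker V) (n + 1)),
      (∀ a, δ a = 0 ↔ ∃ b, τ b - b = a) ∧ ∀ a, r a = 0 ↔ ∃ b, δ b = a := by
  obtain ⟨t, ht⟩ := hf (Multiplicative.ofAdd 1)
  have hX := wangComplex_shortExact (k := k) f V ht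
  have shapiro (m : ℕ) : groupCohomology (coindKer (k := k) f V) m ≃ₗ[k]
      groupCohomology (Rep.trivial k f.ker V) m :=
    (coindIso (Rep.trivial k f.ker V) m).toLinearEquiv
  let e := (shapiro n).toAddEquiv
  let σ : groupCohomology (coindKer (k := k) f V) n ≃+ groupCohomology (coindKer f V) n :=
    ((functor k G n).mapIso (coindKerShiftIso f V t)).toLinearEquiv.toAddEquiv
  have hσ (x : groupCohomology (coindKer (k := k) f V) n) :
      map (MonoidHom.id G) (wangComplex f V t).g n x = σ x - x := by
    have h := map_id_sub (coindKerShift (k := k) f V t) (𝟙 _) n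
    rw [map_id] at h
    exact congrArg (fun φ ↦ φ.hom x) h
  refine ⟨(e.symm.trans σ).trans e,
    (δ hX n (n + 1) rfl).hom.toAddMonoidHom.comp e.symm.toAddMonoidHom,
    (shapiro (n + 1)).toAddEquiv.toAddMonoidHom.comp
      (map (MonoidHom.id G) (wangComplex f V t).f (n + 1)).hom.toAddMonoidHom, fun a ↦ ?_,
      fun a ↦ ?_⟩
  · have h₃ : δ hX n (n + 1) rfl (e.symm a) = 0 ↔ ∃ b, σ b - b = e.symm a := by
      simp_rw [← hσ]
      exact (ShortComplex.ShortExact.moduleCat_exact_iff_function_exact _).1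
        (mapShortComplex₃_exact hX (i := n) rfl) (e.symm a)
    refine h₃.trans ⟨fun ⟨b, hb⟩ ↦ ⟨e b, ?_⟩, fun ⟨b, hb⟩ ↦ ⟨e.symm b, ?_⟩⟩
    · simpa [← map_sub] using congrArg e hb
    · simpa using congrArg e.symm hb
  · have h₁ : map (MonoidHom.id G) (wangComplex f V t).f (n + 1) a = 0 ↔
        ∃ b, δ hX n (n + 1) rfl b = a :=
      (ShortComplex.ShortExact.moduleCat_exact_iff_function_exact _).1
        (mapShortComplex₁_exact hX (i := n) rfl) a
    refine ((shapiro (n + 1)).map_eq_zero_iff).trans <| h₁.trans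
      ⟨fun ⟨b, hb⟩ ↦ ⟨e b, ?_⟩, fun ⟨b, hb⟩ ↦ ⟨e.symm b, hb⟩⟩
    exact (congrArg _ (e.symm_apply_apply b)).trans hb

end groupCohomology

/-- `Hⁿ(G; ℤ)` is `ℤ` or `ℤ/2ℤ`, and the integral cohomology of `G` vanishes above degree `n`. -/
def IsTopCohomologyDegree (G : Type) [Group G] (n : ℕ) : Prop :=
  IsIntOrZModTwo (groupCohomology (Rep.trivial ℤ G ℤ) n) ∧
    ∀ m, n < m → Subsingleton (groupCohomology (Rep.trivial ℤ G ℤ) m)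

namespace IsTopCohomologyDegree

variable {G H : Type} [Group G] [Group H] {n : ℕ}

theorem congr (h : IsTopCohomologyDegree G n) (e : G ≃* H) : IsTopCohomologyDegree H n := by
  have E (m : ℕ) : groupCohomology (Rep.trivial ℤ G ℤ) m ≃+
      groupCohomology (Rep.trivial ℤ H ℤ) m :=
    (groupCohomology.mapIso (A := Rep.trivial ℤ H ℤ) (B := Rep.trivial ℤ G ℤ) e
      (LinearEquiv.refl ℤ ℤ) (fun _ ↦ rfl) m).toLinearEquiv.toAddEquiv
  exact ⟨h.1.congr (E n), fun m hm ↦ have := h.2 m hm; (E m).symm.toEquiv.subsingleton⟩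

theorem of_subsingleton [Subsingleton G] : IsTopCohomologyDegree G 0 := by
  refine ⟨.inl ⟨(groupCohomology.H0IsoOfIsTrivial
    (Rep.trivial ℤ G ℤ)).toLinearEquiv.toAddEquiv⟩, fun m hm ↦ ?_⟩
  obtain ⟨m, rfl⟩ := Nat.exists_eq_add_of_lt hm
  rw [← ModuleCat.isZero_iff_subsingleton]
  convert isZero_groupCohomology_succ_of_subsingleton (Rep.trivial ℤ G ℤ) (0 + m)

theorem of_ker {f : G →* Multiplicative ℤ} (hf : Function.Surjective f)
    (h : IsTopCohomologyDegree f.ker n) : IsTopCohomologyDegree G (n + 1) := by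
  refine ⟨?_, fun m hm ↦ ?_⟩
  · obtain ⟨τ, δ, r, hδ, hr⟩ := groupCohomology.exists_wang_sequence (k := ℤ) f ℤ hf n
    have := h.2 (n + 1) n.lt_succ_self
    exact h.1.of_surjective τ δ (fun a ↦ (hr a).1 (Subsingleton.elim _ _)) hδ
  · obtain ⟨m, rfl⟩ : ∃ m', m = m' + 1 := ⟨m - 1, by omega⟩
    obtain ⟨τ, δ, r, hδ, hr⟩ := groupCohomology.exists_wang_sequence (k := ℤ) f ℤ hf m
    have := h.2 (m + 1) (by omega)
    have := h.2 m (by omega)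
    refine ⟨fun a b ↦ ?_⟩
    obtain ⟨a, rfl⟩ := (hr a).1 (Subsingleton.elim _ _)
    obtain ⟨b, rfl⟩ := (hr b).1 (Subsingleton.elim _ _)
    rw [Subsingleton.elim a b]

end IsTopCohomologyDegree

theorem IsPolyZChain.isTopCohomologyDegree {G : Type} [Group G] {n : ℕ}
    {c : Fin (n + 1) → Subgroup G} (hc : IsPolyZChain c) (i : Fin (n + 1)) :
    IsTopCohomologyDegree (c i) i := by
  obtain ⟨h0, -, hstep⟩ := hc
  induction i using Fin.induction with
  | zero =>
    rw [h0]
    exact .of_subsingleton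
  | succ i ih =>
    obtain ⟨hle, f, hf, hker⟩ := hstep i
    refine .of_ker hf (ih.congr ?_)
    rw [hker]
    exact (Subgroup.subgroupOfEquivOfLe hle).symm

theorem top_cohomology_of_polyZ (G : Type) [Group G] (n : ℕ)
    (c : Fin (n + 1) → Subgroup G) (hc : IsPolyZChain c) :
    Nonempty ((groupCohomology (Rep.trivial ℤ G ℤ) n) ≃+ ℤ) ∨
    Nonempty ((groupCohomology (Rep.trivial ℤ G ℤ) n) ≃+ ZMod 2) := by
  have h := hc.isTopCohomologyDegree (Fin.last n)
  rw [hc.2.1] at h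
  exact (h.congr Subgroup.topEquiv).1
end

section
/- Let G be a poly-ℤ group admitting a chain {1} = G_0 ⊆ G_1 ⊆ … ⊆ G_n = G of subgroups such that G_{i−1} is normal in G_i with infinite cyclic quotient G_i/G_{i−1} for i = 1, …, n. Then H^n(G; ℤ) ≠ 0 for the trivial G-module ℤ, and H^k(G; M) = 0 for every integer k > n and every G-module M. Consequently the cohomological dimension of G equals n, and any two such chains for G have the same length. -/
open CategoryTheory

lemma Int.exists_forall_add_one_sub_eq {A : Type*} [AddCommGroup A] (w : ℤ → A) :
    ∃ x : ℤ → A, ∀ k, x (k + 1) - x k = w k := by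
  refine ⟨fun k ↦ ∑ i ∈ Finset.range k.toNat, w i - ∑ i ∈ Finset.range (-k).toNat, w (-i - 1), ?_⟩
  rintro (k | k)
  · have h1 : (-(k : ℤ)).toNat = 0 := by lia
    have h2 : (-((k : ℤ) + 1)).toNat = 0 := by lia
    have h3 : ((k : ℤ) + 1).toNat = k + 1 := by lia
    simp only [Int.ofNat_eq_natCast, h1, h2, h3, Finset.sum_range_succ]
    simp
  · rw [show Int.negSucc k = -(k : ℤ) - 1 by lia]
    have h1 : (-(-(k : ℤ) - 1)).toNat = k + 1 := by lia
    have h2 : (-(-(k : ℤ) - 1 + 1)).toNat = k := by lia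
    have h3 : (-(k : ℤ) - 1).toNat = 0 := by lia
    have h4 : (-(k : ℤ) - 1 + 1).toNat = 0 := by lia
    simp only [h1, h2, h3, h4, Finset.sum_range_succ]
    simp

lemma Representation.apply_zpow_mul {k G V : Type*} [CommRing k] [Group G] [AddCommGroup V]
    [Module k V] (ρ : Representation k G V) (φ : G → V) (t : G)
    (h : ∀ g, φ (t * g) = ρ t (φ g)) (j : ℤ) (g : G) :
    φ (t ^ j * g) = ρ (t ^ j) (φ g) := by
  induction j generalizing g with
  | zero => simp
  | succ i ih => rw [zpow_add_one, mul_assoc, ih, h, map_mul, Module.End.mul_apply]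
  | pred i ih =>
    have h' : φ (t⁻¹ * g) = ρ t⁻¹ (φ g) := by
      conv_rhs => rw [← mul_inv_cancel_left t g, h]
      simp
    rw [zpow_sub_one, mul_assoc, ih, h', map_mul, Module.End.mul_apply]

namespace Rep

variable {k G : Type} [CommRing k] [Group G] (N : Subgroup G) (M : Rep k G)

/-- The map `m ↦ (g ↦ g • m)` from a `G`-representation to the representation coinduced from its
restriction to a subgroup. -/
noncomputable def coindResUnit : M ⟶ coind N.subtype (res N.subtype M) :=
  resCoindToHom _ _ _ (𝟙 _)

/-- For a normal subgroup `N`, the endomorphism of `Coind_N^G (Res_N M)` sending `φ` to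
`g ↦ t⁻¹ • φ (t * g)`. -/
noncomputable def coindResShift [N.Normal] (t : G) :
    coind N.subtype (res N.subtype M) ⟶ coind N.subtype (res N.subtype M) :=
  Rep.ofHom
    { toFun := fun φ ↦ ⟨fun g ↦ M.ρ t⁻¹ (φ.1 (t * g)), by
        intro s g
        have := φ.2 ⟨t * s * t⁻¹, Subgroup.Normal.conj_mem inferInstance _ s.2 t⟩ (t * g)
        simp only [Subgroup.subtype_apply] at this ⊢
        rw [show t * (s * g) = t * s * t⁻¹ * (t * g) by group, this]
        simp [← Module.End.mul_apply, ← map_mul, mul_assoc]⟩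
      map_add' := fun _ _ ↦ by ext; simp
      map_smul' := fun _ _ ↦ by ext; simp
      isIntertwining' := fun h ↦ by
        ext φ g
        exact congr_arg (fun x ↦ M.ρ t⁻¹ (φ.1 x)) (mul_assoc t g h) }

lemma coindResShift_comp_inv [N.Normal] (t : G) :
    coindResShift N M t ≫ coindResShift N M t⁻¹ = 𝟙 _ := by
  ext φ g
  change M.ρ t⁻¹⁻¹ (M.ρ t⁻¹ (φ.1 (t * (t⁻¹ * g)))) = φ.1 g
  simp

/-- The sequence `M ⟶ Coind_N^G (Res_N M) ⟶ Coind_N^G (Res_N M)` whose second map is the shift by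
`t` minus the identity; its long exact sequence is the Wang sequence when `G ⧸ N` is infinite
cyclic, generated by `t`. -/
noncomputable def wangComplex [N.Normal] (t : G) : ShortComplex (Rep k G) where
  X₁ := M
  X₂ := coind N.subtype (res N.subtype M)
  X₃ := coind N.subtype (res N.subtype M)
  f := coindResUnit N M
  g := coindResShift N M t - 𝟙 _
  zero := by
    ext m g
    change M.ρ t⁻¹ (M.ρ (t * g) m) - M.ρ g m = 0
    simp [← Module.End.mul_apply, ← map_mul]

lemma wangComplex_shortExact (f : G →* Multiplicative ℤ) (t : G)
    (ht : f t = Multiplicative.ofAdd 1) : (wangComplex f.ker M t).ShortExact := by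
  have hft (j : ℤ) : f (t ^ j) = Multiplicative.ofAdd j := by
    rw [map_zpow, ht, ← ofAdd_zsmul]; simp
  refine .mk' ?_ ?_ ?_
  · apply Functor.reflects_exact_of_faithful (forget₂ (Rep k G) (ModuleCat k))
    rw [ShortComplex.moduleCat_exact_iff]
    intro (φ : coind f.ker.subtype (res f.ker.subtype M)) hφ
    have h_shift (g : G) : φ.1 (t * g) = M.ρ t (φ.1 g) := by
      have := congr_fun (congr_arg Subtype.val hφ) g
      change M.ρ t⁻¹ (φ.1 (t * g)) - φ.1 g = 0 at this
      rw [← sub_eq_zero.1 this]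
      simp
    refine ⟨φ.1 1, Subtype.ext (funext fun g ↦ ?_)⟩
    change M.ρ g (φ.1 1) = φ.1 g
    obtain ⟨j, s, hs, rfl⟩ : ∃ (j : ℤ) (s : G), s ∈ f.ker ∧ g = s * t ^ j :=
      ⟨(f g).toAdd, g * (t ^ (f g).toAdd)⁻¹, by simp [MonoidHom.mem_ker, hft], by simp⟩
    have h1 : φ.1 (s * t ^ j) = M.ρ s (φ.1 (t ^ j)) := φ.2 ⟨s, hs⟩ (t ^ j)
    have h2 := M.ρ.apply_zpow_mul φ.1 t h_shift j 1
    rw [mul_one] at h2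
    rw [h1, h2, map_mul, Module.End.mul_apply]
  · rw [mono_iff_injective]
    intro (x : M) (y : M) h
    have := congr_fun (congr_arg Subtype.val h) 1
    change M.ρ 1 x = M.ρ 1 y at this
    rwa [map_one, Module.End.one_apply, Module.End.one_apply] at this
  · rw [epi_iff_surjective]
    intro (ψ : coind f.ker.subtype (res f.ker.subtype M))
    obtain ⟨x, hx⟩ := Int.exists_forall_add_one_sub_eq fun j ↦ M.ρ (t ^ j)⁻¹ (ψ.1 (t ^ j))
    refine ⟨⟨fun g ↦ M.ρ g (x (f g).toAdd), ?_⟩, Subtype.ext (funext fun g ↦ ?_)⟩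
    · rintro ⟨s, hs⟩ g
      rw [MonoidHom.mem_ker] at hs
      simp [hs]
    · change M.ρ t⁻¹ (M.ρ (t * g) (x (f (t * g)).toAdd)) - M.ρ g (x (f g).toAdd) = ψ.1 g
      have h1 : ψ.1 (g * (t ^ (f g).toAdd)⁻¹ * t ^ (f g).toAdd) =
          M.ρ (g * (t ^ (f g).toAdd)⁻¹) (ψ.1 (t ^ (f g).toAdd)) :=
        ψ.2 ⟨g * (t ^ (f g).toAdd)⁻¹, by simp [MonoidHom.mem_ker, hft]⟩ (t ^ (f g).toAdd)
      rw [inv_mul_cancel_right, map_mul, Module.End.mul_apply, ← hx] at h1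
      rw [h1]
      simp [ht, add_comm]

end Rep

/-- An abelian group `A` is cyclic modulo two if `A / 2A` has order two. -/
def IsCyclicModTwo (A : Type*) [AddCommGroup A] : Prop :=
  ∃ ε : A →+ ZMod 2, Function.Surjective ε ∧ ∀ a, ε a = 0 → ∃ b, a = b + b

namespace IsCyclicModTwo

variable {A B : Type*} [AddCommGroup A] [AddCommGroup B]

lemma nontrivial (h : IsCyclicModTwo A) : Nontrivial A := by
  obtain ⟨ε, hε, -⟩ := h
  exact hε.nontrivial

lemma of_addEquiv (e : A ≃+ B) (h : IsCyclicModTwo A) : IsCyclicModTwo B := by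
  obtain ⟨ε, hε, h2⟩ := h
  refine ⟨ε.comp e.symm.toAddMonoidHom, hε.comp e.symm.surjective, fun b hb ↦ ?_⟩
  obtain ⟨a, ha⟩ := h2 _ hb
  exact ⟨e a, by rw [← map_add, ← ha]; simp⟩

lemma int : IsCyclicModTwo ℤ := by
  refine ⟨Int.castAddHom (ZMod 2), ZMod.intCast_surjective, fun a ha ↦ ?_⟩
  rw [Int.coe_castAddHom, ZMod.intCast_zmod_eq_zero_iff_dvd] at ha
  exact even_iff_two_dvd.2 ha

lemma of_surjective (h : IsCyclicModTwo A) (T S : A →+ A) (hST : ∀ a, S (T a) = a)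
    (δ : A →+ B) (hδ : Function.Surjective δ) (hker : ∀ a, δ a = 0 → ∃ b, T b - b = a) :
    IsCyclicModTwo B := by
  obtain ⟨ε, hε, h2⟩ := h
  have hT (a : A) : ε (T a) = ε a := by
    have h_zero : ε a = 0 ↔ ε (T a) = 0 := by
      constructor <;> intro h
      · obtain ⟨b, rfl⟩ := h2 _ h
        rw [map_add, map_add, CharTwo.add_self_eq_zero]
      · obtain ⟨b, hb⟩ := h2 _ h
        rw [← hST a, hb, map_add, map_add, CharTwo.add_self_eq_zero]
    revert h_zero
    generalize ε a = x
    generalize ε (T a) = y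
    revert x y
    decide
  have hle : δ.ker ≤ ε.ker := by
    intro a ha
    obtain ⟨b, rfl⟩ := hker a ha
    rw [AddMonoidHom.mem_ker, map_sub, hT, sub_self]
  obtain ⟨ε', hlift⟩ : ∃ ε' : B →+ ZMod 2, ∀ a, ε' (δ a) = ε a :=
    ⟨_, δ.liftOfRightInverse_comp_apply _ (Function.rightInverse_surjInv hδ) ⟨ε, hle⟩⟩
  refine ⟨ε', fun x ↦ ?_, fun b hb ↦ ?_⟩
  · obtain ⟨a, rfl⟩ := hε x
    exact ⟨δ a, hlift a⟩
  · obtain ⟨a, rfl⟩ := hδ b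
    rw [hlift] at hb
    obtain ⟨c, rfl⟩ := h2 a hb
    exact ⟨δ c, map_add δ c c⟩

end IsCyclicModTwo

namespace groupCohomology

variable {k G : Type} [CommRing k] [Group G] (f : G →* Multiplicative ℤ)

instance functor_additive (n : ℕ) : (functor k G n).Additive :=
  inferInstanceAs ((cochainsFunctor k G ⋙ HomologicalComplex.homologyFunctor _ _ n).Additive)

lemma subsingleton_succ_of_ker (hf : Function.Surjective f) (M : Rep k G) (i : ℕ)
    (h0 : Subsingleton (groupCohomology (Rep.res f.ker.subtype M) i))
    (h1 : Subsingleton (groupCohomology (Rep.res f.ker.subtype M) (i + 1))) :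
    Subsingleton (groupCohomology M (i + 1)) := by
  obtain ⟨t, ht⟩ := hf (Multiplicative.ofAdd 1)
  rw [← ModuleCat.isZero_iff_subsingleton] at h0 h1 ⊢
  have hX := Rep.wangComplex_shortExact M f t ht
  have : Epi (δ hX i (i + 1) rfl) :=
    epi_δ_of_isZero hX i (h1.of_iso (coindIso (Rep.res f.ker.subtype M) (i + 1)))
  exact @Limits.IsZero.of_epi _ _ _ _ _ (δ hX i (i + 1) rfl) this
    (h0.of_iso (coindIso (Rep.res f.ker.subtype M) i))

lemma isCyclicModTwo_succ_of_ker (hf : Function.Surjective f) (M : Rep k G) (i : ℕ)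
    (h0 : IsCyclicModTwo (groupCohomology (Rep.res f.ker.subtype M) i))
    (h1 : Subsingleton (groupCohomology (Rep.res f.ker.subtype M) (i + 1))) :
    IsCyclicModTwo (groupCohomology M (i + 1)) := by
  obtain ⟨t, ht⟩ := hf (Multiplicative.ofAdd 1)
  have hX := Rep.wangComplex_shortExact M f t ht
  have := epi_δ_of_isZero hX i ((ModuleCat.isZero_iff_subsingleton.2 h1).of_iso
    (coindIso (Rep.res f.ker.subtype M) (i + 1)))
  have h0 := h0.of_addEquiv
    (coindIso (Rep.res f.ker.subtype M) i).toLinearEquiv.symm.toAddEquiv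
  refine h0.of_surjective
    ((functor k G i).map (Rep.coindResShift f.ker M t)).hom.toAddMonoidHom
    ((functor k G i).map (Rep.coindResShift f.ker M t⁻¹)).hom.toAddMonoidHom (fun a ↦ ?_)
    (δ hX i (i + 1) rfl).hom.toAddMonoidHom
    ((ModuleCat.epi_iff_surjective _).1 this) fun a ha ↦ ?_
  · have := (functor k G i).congr_map (Rep.coindResShift_comp_inv f.ker M t)
    rw [Functor.map_comp, CategoryTheory.Functor.map_id] at this
    exact congr($this a)
  · obtain ⟨b, hb⟩ := (ShortComplex.moduleCat_exact_iff _).1 (mapShortComplex₃_exact hX rfl) a ha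
    refine ⟨b, Eq.trans ?_ hb⟩
    have := (functor k G i).map_sub (f := Rep.coindResShift f.ker M t) (g := 𝟙 _)
    rw [CategoryTheory.Functor.map_id] at this
    exact congr($this.symm b)

end groupCohomology

/-- A group is poly-ℤ of length `n` if it is trivial and `n = 0`, or it surjects onto `ℤ` with
kernel poly-ℤ of length `n - 1`. -/
def IsPolyZ : ℕ → (G : Type) → [Group G] → Prop
  | 0, G, _ => Subsingleton G
  | n + 1, G, _ => ∃ f : G →* Multiplicative ℤ, Function.Surjective f ∧ IsPolyZ n f.ker

namespace IsPolyZ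

lemma of_mulEquiv {n : ℕ} {G H : Type} [Group G] [Group H] (e : G ≃* H) (h : IsPolyZ n G) :
    IsPolyZ n H := by
  induction n generalizing G H with
  | zero => exact @Equiv.subsingleton.symm _ _ e.toEquiv h
  | succ n ih =>
    obtain ⟨f, hf, hn⟩ := h
    refine ⟨f.comp e.symm.toMonoidHom, hf.comp e.symm.surjective, ?_⟩
    refine ih ((e.subgroupMap f.ker).trans (MulEquiv.subgroupCongr ?_)) hn
    ext x
    simp [Subgroup.mem_map, MonoidHom.mem_ker]

lemma subsingleton_and_isCyclicModTwo_groupCohomology {n : ℕ} {G : Type} [Group G] (h : IsPolyZ n G) :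
    (∀ k, n < k → ∀ M : Rep ℤ G, Subsingleton (groupCohomology M k)) ∧
      IsCyclicModTwo (groupCohomology (Rep.trivial ℤ G ℤ) n) := by
  induction n generalizing G with
  | zero =>
    have : Subsingleton G := h
    refine ⟨fun k hk M ↦ ?_, IsCyclicModTwo.int.of_addEquiv
      (groupCohomology.H0IsoOfIsTrivial (Rep.trivial ℤ G ℤ)).toLinearEquiv.symm.toAddEquiv⟩
    obtain ⟨k, rfl⟩ := Nat.exists_eq_add_one.2 hk
    exact ModuleCat.subsingleton_of_isZero (isZero_groupCohomology_succ_of_subsingleton M k)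
  | succ n ih =>
    obtain ⟨f, hf, hn⟩ := h
    obtain ⟨ih1, ih2⟩ := ih hn
    refine ⟨fun k hk M ↦ ?_, groupCohomology.isCyclicModTwo_succ_of_ker f hf _ n ih2
      (ih1 _ n.lt_succ_self _)⟩
    obtain ⟨k, rfl⟩ := Nat.exists_eq_add_one.2 (n.zero_lt_succ.trans hk)
    exact groupCohomology.subsingleton_succ_of_ker f hf M k (ih1 _ (by lia) _) (ih1 _ (by lia) _)

end IsPolyZ

lemma IsPolyZChain.isPolyZ {G : Type} [Group G] {n : ℕ} {c : Fin (n + 1) → Subgroup G}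
    (hc : IsPolyZChain c) : IsPolyZ n G := by
  obtain ⟨h_bot, h_top, h_step⟩ := hc
  have key (i : Fin (n + 1)) : IsPolyZ i (c i) := by
    induction i using Fin.induction with
    | zero =>
      rw [h_bot]
      exact inferInstanceAs (Subsingleton (⊥ : Subgroup G))
    | succ i ih =>
      obtain ⟨hle, f, hf, hker⟩ := h_step i
      exact ⟨f, hf, ih.of_mulEquiv ((Subgroup.subgroupOfEquivOfLe hle).symm.trans
        (MulEquiv.subgroupCongr hker.symm))⟩
  exact (key (Fin.last n)).of_mulEquiv
    ((MulEquiv.subgroupCongr h_top).trans Subgroup.topEquiv)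

theorem cohomological_dimension_of_polyZ (G : Type) [Group G] (n : ℕ)
    (c : Fin (n + 1) → Subgroup G) (hc : IsPolyZChain c) :
    Nontrivial (groupCohomology (Rep.trivial ℤ G ℤ) n) ∧
    (∀ k : ℕ, n < k → ∀ M : Rep ℤ G, Subsingleton (groupCohomology M k)) ∧
    (∀ m : ℕ, ∀ c' : Fin (m + 1) → Subgroup G, IsPolyZChain c' → m = n) := by
  obtain ⟨h_vanish, h_cyclic⟩ := hc.isPolyZ.subsingleton_and_isCyclicModTwo_groupCohomology
  refine ⟨h_cyclic.nontrivial, h_vanish, fun m c' hc' ↦ ?_⟩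
  obtain ⟨h_vanish', h_cyclic'⟩ := hc'.isPolyZ.subsingleton_and_isCyclicModTwo_groupCohomology
  rcases lt_trichotomy m n with h | h | h
  · exact (not_subsingleton_iff_nontrivial.2 h_cyclic.nontrivial (h_vanish' n h _)).elim
  · exact h
  · exact (not_subsingleton_iff_nontrivial.2 h_cyclic'.nontrivial (h_vanish m h _)).elim
end

section
/- Let n ≥ 2 and let 1 → A → G →^p ℤ → 1 be a short exact sequence of groups with A ≅ ℤ^n (A a normal subgroup of G, p a surjective homomorphism onto ℤ with kernel A). Fix g₀ ∈ G with p(g₀) = 1 and let φ : A → A be the automorphism given by conjugation with g₀. Assume φ is not periodic, i.e. φ^k ≠ id_A for every nonzero integer k. Then every element v ∈ G whose centralizer C_G(v) has finite index in G lies in A, i.e. satisfies p(v) = 0. -/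
theorem finite_index_centralizer_mem_kernel
    (G : Type*) [Group G] (n : ℕ) (hn : 2 ≤ n)
    (p : G →* Multiplicative ℤ) (hp : Function.Surjective p)
    (A : Subgroup G) (hA : p.ker = A)
    (hAiso : Nonempty (A ≃* Multiplicative (Fin n → ℤ)))
    (g₀ : G) (hg₀ : p g₀ = Multiplicative.ofAdd 1)
    (hnotper : ∀ k : ℤ, k ≠ 0 → ∃ a ∈ A, g₀ ^ k * a * (g₀ ^ k)⁻¹ ≠ a) :
    ∀ v : G, (Subgroup.centralizer {v}).FiniteIndex → v ∈ A := by
  intro v hv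
  obtain ⟨e⟩ := hAiso
  subst hA
  have hcomm : ∀ a ∈ p.ker, ∀ b ∈ p.ker, a * b = b * a := by
    intro a ha b hb
    have h : (⟨a, ha⟩ : p.ker) * ⟨b, hb⟩ = ⟨b, hb⟩ * ⟨a, ha⟩ :=
      e.injective (by rw [map_mul, map_mul, mul_comm])
    exact congrArg Subtype.val h
  have hroot : ∀ a ∈ p.ker, ∀ b ∈ p.ker, ∀ m : ℕ, 0 < m → a ^ m = b ^ m → a = b := by
    intro a ha b hb m hm hab
    have h : (⟨a, ha⟩ : p.ker) ^ m = ⟨b, hb⟩ ^ m := Subtype.ext hab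
    have h' := congrArg (fun x => Multiplicative.toAdd (e x)) h
    simp only [map_pow, toAdd_pow] at h'
    have h'' : e ⟨a, ha⟩ = e ⟨b, hb⟩ := by
      apply Multiplicative.toAdd.injective
      funext i
      have hi := congrFun h' i
      simp only [Pi.smul_apply, nsmul_eq_mul] at hi
      exact mul_left_cancel₀ (by exact_mod_cast hm.ne') hi
    exact congrArg Subtype.val (e.injective h'')
  by_contra hvA
  have hk : (p v).toAdd ≠ 0 := fun h => hvA (MonoidHom.mem_ker.2 (toAdd_eq_zero.1 h))
  obtain ⟨a, ha, hne⟩ := hnotper _ hk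
  apply hne
  have hb : (g₀ ^ (p v).toAdd)⁻¹ * v ∈ p.ker := by
    have hg : p (g₀ ^ (p v).toAdd) = p v := by
      rw [map_zpow, hg₀, ← ofAdd_zsmul, smul_eq_mul, mul_one, ofAdd_toAdd]
    rw [MonoidHom.mem_ker, map_mul, map_inv, hg, inv_mul_cancel]
  obtain ⟨m, hm, -, hmem⟩ := Subgroup.exists_pow_mem_of_index_ne_zero hv.index_ne_zero a
  have hconj : v * a * v⁻¹ = a := by
    refine hroot _ (p.normal_ker.conj_mem a ha v) _ ha m hm ?_
    rw [conj_pow, Subgroup.mem_centralizer_singleton_iff.1 hmem |>.symm, mul_inv_cancel_right]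
  have hba := hcomm _ hb a ha
  calc g₀ ^ (p v).toAdd * a * (g₀ ^ (p v).toAdd)⁻¹
      = g₀ ^ (p v).toAdd * (a * ((g₀ ^ (p v).toAdd)⁻¹ * v)) * v⁻¹ := by group
    _ = g₀ ^ (p v).toAdd * ((g₀ ^ (p v).toAdd)⁻¹ * v * a) * v⁻¹ := by rw [hba]
    _ = v * a * v⁻¹ := by group
    _ = a := hconj
end

section
/- Let p : G → Q be a surjective group homomorphism with finite kernel, and let H be a subgroup of Q such that the preimage p⁻¹(H) is finitely generated. Then the center Z(p⁻¹(H)) of p⁻¹(H) is contained in p⁻¹(Z(H)), and Z(p⁻¹(H)) has finite index in p⁻¹(Z(H)). -/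
/-- Membership in the center of a subgroup, regarded as a subgroup of the ambient group. -/
theorem Subgroup.mem_map_subtype_center {G : Type*} [Group G] {L : Subgroup G} {x : G} :
    x ∈ (Subgroup.center L).map L.subtype ↔ x ∈ L ∧ ∀ y ∈ L, y * x = x * y := by
  simp only [Subgroup.mem_map, Subgroup.mem_center_iff, Subtype.exists, Subtype.forall,
    Subgroup.subtype_apply, Subtype.ext_iff, Subgroup.coe_mul]
  constructor
  · rintro ⟨a, ha, hc, rfl⟩
    exact ⟨ha, hc⟩
  · rintro ⟨hx, hc⟩
    exact ⟨x, hx, hc, rfl⟩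

/-- A subgroup has finite index if it separates the fibres of a map to a finite type. -/
theorem Subgroup.finiteIndex_of_finite_invariant {G α : Type*} [Group G] [Finite α]
    (N : Subgroup G) (f : G → α) (hf : ∀ a b, f a = f b → a⁻¹ * b ∈ N) : N.FiniteIndex := by
  have : Finite (G ⧸ N) := by
    refine Finite.of_injective (fun q : G ⧸ N => f q.out) fun q r hqr => ?_
    rw [← q.out_eq', ← r.out_eq']
    exact QuotientGroup.eq.2 (hf _ _ hqr)
  exact Subgroup.finiteIndex_of_finite_quotient

theorem center_preimage_finite_index
    (G Q : Type*) [Group G] [Group Q] (p : G →* Q)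
    (hp : Function.Surjective p) (hker : Finite p.ker)
    (H : Subgroup Q) (hfg : (H.comap p).FG) :
    (Subgroup.center (H.comap p)).map (H.comap p).subtype ≤
      ((Subgroup.center H).map H.subtype).comap p ∧
    (((Subgroup.center (H.comap p)).map (H.comap p).subtype).subgroupOf
      (((Subgroup.center H).map H.subtype).comap p)).FiniteIndex := by
  constructor
  · intro x hx
    obtain ⟨hxH, hxc⟩ := Subgroup.mem_map_subtype_center.1 hx
    refine Subgroup.mem_comap.2 (Subgroup.mem_map_subtype_center.2 ⟨hxH, fun y hy => ?_⟩)
    obtain ⟨g, rfl⟩ := hp y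
    rw [← map_mul, hxc g hy, map_mul]
  · obtain ⟨S, hS⟩ := hfg
    have hSH (s : S) : p s ∈ H := by
      have h : (s : G) ∈ H.comap p := hS ▸ Subgroup.subset_closure s.2
      exact h
    have hcomm (k : ((Subgroup.center H).map H.subtype).comap p) (s : S) :
        (k : G) * s * (k : G)⁻¹ * (s : G)⁻¹ ∈ p.ker := by
      have h := (Subgroup.mem_map_subtype_center.1 (Subgroup.mem_comap.1 k.2)).2 _ (hSH s)
      simp [MonoidHom.mem_ker, ← h]
    refine Subgroup.finiteIndex_of_finite_invariant _
      (fun k (s : S) => (⟨_, hcomm k s⟩ : p.ker)) fun a b hab => ?_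
    rw [Subgroup.mem_subgroupOf, Subgroup.mem_map_subtype_center]
    refine ⟨(Subgroup.mem_map_subtype_center.1 (Subgroup.mem_comap.1 (a⁻¹ * b).2)).1, ?_⟩
    suffices h : H.comap p ≤ Subgroup.centralizer {((a⁻¹ * b : _) : G)} from
      fun y hy => (Subgroup.mem_centralizer_singleton_iff.1 (h hy))
    rw [← hS, Subgroup.closure_le]
    intro s hs
    have h : (a : G) * s * (a : G)⁻¹ * s⁻¹ = b * s * (b : G)⁻¹ * s⁻¹ :=
      congrArg Subtype.val (congrFun hab ⟨s, hs⟩)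
    have h' : (a : G) * s * (a : G)⁻¹ = b * s * (b : G)⁻¹ := mul_right_cancel h
    refine Subgroup.mem_centralizer_singleton_iff.2 ?_
    calc s * ((a : G)⁻¹ * b) = (a : G)⁻¹ * (a * s * (a : G)⁻¹) * b := by group
      _ = (a : G)⁻¹ * b * s := by rw [h']; group
end

section
/- Let H be a group whose center Z(H) is infinite cyclic and such that the quotient H/Z(H) is a finitely generated free abelian group. Let f be an automorphism of H and let f̄ be the induced automorphism of H/Z(H) (f maps Z(H) to Z(H), so f̄ is well defined). If f̄ has finite order, then some positive power of f is an inner automorphism of H: there exist an integer m ≥ 1 and an element h ∈ H such that f^m(x) = h x h⁻¹ for all x ∈ H. -/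
open scoped commutatorElement IsMulCommutative

/-- An injective endomorphism of `ℤⁿ` has an image of finite exponent in `ℤⁿ`. -/
theorem exists_pos_nsmul_eq_of_injective {n : ℕ} (L : (Fin n → ℤ) →+ (Fin n → ℤ))
    (hL : Function.Injective L) (w : Fin n → ℤ) : ∃ m : ℕ, 0 < m ∧ ∃ v, L v = m • w := by
  set M := LinearMap.toMatrix' L.toIntLinearMap with hM
  have hLM (v : Fin n → ℤ) : L v = M.mulVec v := by
    rw [hM, LinearMap.toMatrix'_mulVec]
    rfl
  have hdet : M.det ≠ 0 := by
    intro h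
    obtain ⟨v, hv, hv0⟩ := Matrix.exists_mulVec_eq_zero_iff.mpr h
    exact hv (hL (by rw [hLM, hv0, map_zero]))
  have hadj : L (M.adjugate.mulVec w) = M.det • w := by
    rw [hLM, Matrix.mulVec_mulVec, Matrix.mul_adjugate, Matrix.smul_mulVec, Matrix.one_mulVec]
  refine ⟨M.det.natAbs, Int.natAbs_pos.mpr hdet, ?_⟩
  rcases Int.natAbs_eq M.det with h | h
  · exact ⟨_, by rw [hadj, ← natCast_zsmul, ← h]⟩
  · refine ⟨-M.adjugate.mulVec w, ?_⟩
    rw [map_neg, hadj, ← natCast_zsmul, ← neg_smul, eq_neg_iff_add_eq_zero.mpr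
      (by omega : ((M.det.natAbs : ℕ) : ℤ) + M.det = 0)]

/-- A subgroup containing the kernel of a homomorphism to `ℤⁿ` and preimages of the standard
basis vectors is the whole group. -/
theorem Subgroup.eq_top_of_ker_le_of_basis_mem {H : Type*} [Group H] {n : ℕ}
    (E : H →* Multiplicative (Fin n → ℤ)) (b : Fin n → H)
    (hb : ∀ i, E (b i) = Multiplicative.ofAdd (Pi.single i 1)) (K : Subgroup H)
    (hker : E.ker ≤ K) (hbK : ∀ i, b i ∈ K) : K = ⊤ := by
  have hmap (a : Fin n → ℤ) : Multiplicative.ofAdd a ∈ K.map E := by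
    rw [← Finset.univ_sum_single a, ofAdd_sum]
    refine Subgroup.prod_mem _ fun i _ => ⟨b i ^ a i, K.zpow_mem (hbK i) _, ?_⟩
    rw [map_zpow, hb, ← ofAdd_zsmul, ← Pi.single_smul, smul_eq_mul, mul_one]
  refine eq_top_iff.mpr fun x _ => ?_
  obtain ⟨y, hy, hyx⟩ := hmap (E x).toAdd
  have : y⁻¹ * x ∈ K := hker (by
    rw [MonoidHom.mem_ker, map_mul, map_inv, hyx, ofAdd_toAdd, inv_mul_cancel])
  simpa using K.mul_mem hy this

/-- In a group whose commutators are central, the commutator as a bimultiplicative map. -/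
def commutatorHom {H : Type*} [Group H] (hc : ∀ x y : H, ⁅x, y⁆ ∈ Subgroup.center H) :
    H →* H →* Subgroup.center H :=
  MonoidHom.mk' (fun h => MonoidHom.mk' (fun x => ⟨⁅h, x⁆, hc h x⟩) fun x y => by
    ext
    have := Subgroup.mem_center_iff.mp (hc h y) x
    simp only [Subgroup.coe_mul]
    calc ⁅h, x * y⁆ = ⁅h, x⁆ * (x * ⁅h, y⁆) * x⁻¹ := by simp only [commutatorElement_def]; group
      _ = ⁅h, x⁆ * ⁅h, y⁆ := by rw [this]; group) fun h g => by
    ext x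
    have := Subgroup.mem_center_iff.mp (hc g x) h
    have h2 := Subgroup.mem_center_iff.mp (hc g x) ⁅h, x⁆
    simp only [MonoidHom.mul_apply, Subgroup.coe_mul, MonoidHom.mk'_apply]
    calc ⁅h * g, x⁆ = (h * ⁅g, x⁆) * h⁻¹ * ⁅h, x⁆ := by simp only [commutatorElement_def]; group
      _ = ⁅h, x⁆ * ⁅g, x⁆ := by rw [this, h2]; group

@[simp]
theorem coe_commutatorHom_apply {H : Type*} [Group H]
    (hc : ∀ x y : H, ⁅x, y⁆ ∈ Subgroup.center H) (h x : H) :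
    (commutatorHom hc h x : H) = ⁅h, x⁆ := rfl

/-- An automorphism `g` fixing the center pointwise and acting trivially modulo the center
yields the homomorphism `x ↦ x⁻¹ * g x` to the center. -/
def MulAut.centralDisplacement {H : Type*} [Group H] (g : MulAut H)
    (hg : ∀ x, x⁻¹ * g x ∈ Subgroup.center H) : H →* Subgroup.center H :=
  MonoidHom.mk' (fun x => ⟨x⁻¹ * g x, hg x⟩) fun x y => by
    ext
    have := Subgroup.mem_center_iff.mp (hg x) y⁻¹
    simp only [Subgroup.coe_mul, map_mul]
    calc (x * y)⁻¹ * (g x * g y) = y⁻¹ * (x⁻¹ * g x) * g y := by group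
      _ = x⁻¹ * g x * (y⁻¹ * g y) := by rw [this]; group

theorem MulAut.pow_apply_eq_mul_centralDisplacement {H : Type*} [Group H] (g : MulAut H)
    (hg : ∀ x, x⁻¹ * g x ∈ Subgroup.center H) (hz : ∀ z ∈ Subgroup.center H, g z = z)
    (m : ℕ) (x : H) : (g ^ m) x = x * (g.centralDisplacement hg x : H) ^ m := by
  induction m with
  | zero => simp
  | succ m ih =>
    rw [pow_succ', MulAut.mul_apply, ih, map_mul, map_pow, hz _ (Subtype.prop _), pow_succ',
      ← mul_assoc]
    congr 1
    simp [MulAut.centralDisplacement]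

/-- The square of an automorphism fixes an infinite cyclic center pointwise. -/
theorem MulAut.sq_apply_of_mem_center {H : Type*} [Group H]
    (hcyc : IsCyclic (Subgroup.center H)) (hinf : Infinite (Subgroup.center H))
    (f : MulAut H) {z : H} (hz : z ∈ Subgroup.center H) : (f ^ 2) z = z := by
  obtain ⟨t, ht⟩ := hcyc.exists_generator
  have hmem (g : MulAut H) : g t ∈ Subgroup.center H :=
    (Subgroup.characteristic_iff_map_le.mp inferInstance g) ⟨t, t.2, rfl⟩
  have hpow (g : MulAut H) : ∃ a : ℤ, g t = (t : H) ^ a := by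
    obtain ⟨a, ha⟩ := ht ⟨_, hmem g⟩
    exact ⟨a, by simpa using (congrArg Subtype.val ha).symm⟩
  obtain ⟨a, ha⟩ := hpow f
  obtain ⟨b, hb⟩ := hpow f⁻¹
  have hab : a * b = 1 := by
    have h1 : f (f⁻¹ t) = t := by simp
    rw [hb, map_zpow, ha, ← zpow_mul] at h1
    have h2 : t ^ (a * b) = t ^ (1 : ℤ) := by ext; simpa using h1
    exact injective_zpow_iff_not_isOfFinOrder.mpr 
      (orderOf_eq_zero_iff.mp (Infinite.orderOf_eq_zero_of_forall_mem_zpowers ht)) h2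
  have haa : a * a = 1 := by
    rcases Int.eq_one_or_neg_one_of_mul_eq_one hab with rfl | rfl <;> rfl
  obtain ⟨c, hc⟩ := ht ⟨z, hz⟩
  obtain rfl : (t : H) ^ c = z := by simpa using congrArg Subtype.val hc
  rw [map_zpow, pow_two, MulAut.mul_apply, ha, map_zpow, ha, ← zpow_mul, ← zpow_mul,
    ← mul_assoc, haa, one_mul]

theorem commutator_mem_center_of_quotient_comm {H A : Type*} [Group H] [CommGroup A]
    (E : H →* A) (hE : E.ker = Subgroup.center H) (x y : H) : ⁅x, y⁆ ∈ Subgroup.center H := by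
  rw [← hE, MonoidHom.mem_ker, map_commutatorElement, commutatorElement_eq_one_iff_mul_comm,
    mul_comm]

/-- Up to a positive power, every homomorphism to the center killing the center is a
commutator homomorphism. -/
theorem exists_commutatorHom_eq_pow {H : Type*} [Group H]
    (hcyc : IsCyclic (Subgroup.center H)) (hinf : Infinite (Subgroup.center H)) {n : ℕ}
    (e : (H ⧸ Subgroup.center H) ≃* Multiplicative (Fin n → ℤ))
    (hc : ∀ x y : H, ⁅x, y⁆ ∈ Subgroup.center H) (χ : H →* Subgroup.center H)
    (hχ : ∀ z ∈ Subgroup.center H, χ z = 1) :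
    ∃ m : ℕ, 0 < m ∧ ∃ h : H, commutatorHom hc h = χ ^ m := by
  let E : H →* Multiplicative (Fin n → ℤ) :=
    e.toMonoidHom.comp (QuotientGroup.mk' (Subgroup.center H))
  have hE : E.ker = Subgroup.center H := by
    ext x
    simp [E]
  have hEs : Function.Surjective E := e.surjective.comp (QuotientGroup.mk'_surjective _)
  choose b hb using fun i : Fin n => hEs (Multiplicative.ofAdd (Pi.single i 1))
  have hhom (α β : H →* Subgroup.center H) (hα : ∀ z ∈ Subgroup.center H, α z = 1)
      (hβ : ∀ z ∈ Subgroup.center H, β z = 1) (hαβ : ∀ i, α (b i) = β (b i)) : α = β := by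
    have := Subgroup.eq_top_of_ker_le_of_basis_mem E b hb (α.eqLocus β)
      (fun z hz => (hα z (hE ▸ hz)).trans (hβ z (hE ▸ hz)).symm) hαβ
    exact MonoidHom.eq_of_eqOn_top fun x _ => (this ▸ Subgroup.mem_top x : x ∈ α.eqLocus β)
  have hcomm (h z : H) (hz : z ∈ Subgroup.center H) : commutatorHom hc h z = 1 := by
    ext
    simpa [commutatorElement_eq_one_iff_mul_comm] using Subgroup.mem_center_iff.mp hz h
  let c : Subgroup.center H ≃* Multiplicative ℤ := mulEquivOfCyclicCardEq (by simp)
  let ev : (H →* Subgroup.center H) →* Multiplicative (Fin n → ℤ) :=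
    MonoidHom.mk' (fun α => Multiplicative.ofAdd fun i => (c (α (b i))).toAdd) fun α β => by
      rw [← ofAdd_add]
      congr 1
      ext i
      simp
  have hev (α β : H →* Subgroup.center H) (h : ev α = ev β) (i : Fin n) : α (b i) = β (b i) :=
    c.injective (congrFun (Multiplicative.ofAdd.injective h) i)
  let T := ev.comp (commutatorHom hc)
  have hT : T.ker = Subgroup.center H := by
    ext h
    constructor
    · intro hh
      have := hhom _ 1 (hcomm h) (fun _ _ => rfl) (hev _ _ (hh.trans (map_one ev).symm))
      refine Subgroup.mem_center_iff.mpr fun x => ?_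
      have hx := congrArg Subtype.val (DFunLike.congr_fun this x)
      exact (commutatorElement_eq_one_iff_mul_comm.mp hx).symm
    · intro hh
      have : commutatorHom hc h = 1 := by
        ext x
        simpa [commutatorElement_eq_one_iff_mul_comm] using (Subgroup.mem_center_iff.mp hh x).symm
      rw [MonoidHom.mem_ker, MonoidHom.comp_apply, this, map_one]
  let L : Multiplicative (Fin n → ℤ) →* Multiplicative (Fin n → ℤ) :=
    (QuotientGroup.lift (Subgroup.center H) T hT.ge).comp e.symm.toMonoidHom
  have hLE (h : H) : L (E h) = T h := by simp [L, E]
  have hL : Function.Injective L := by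
    refine (injective_iff_map_eq_one L).mpr fun v hv => ?_
    obtain ⟨h, rfl⟩ := hEs v
    rw [hLE] at hv
    exact hE.ge (hT.le hv)
  obtain ⟨m, hm, v, hv⟩ := exists_pos_nsmul_eq_of_injective
    (AddMonoidHom.toMultiplicative.symm L) hL (ev χ).toAdd
  obtain ⟨h, hh⟩ := hEs (Multiplicative.ofAdd v)
  refine ⟨m, hm, h, hhom _ _ (hcomm h) (fun z hz => by simp [hχ z hz]) (hev _ _ ?_)⟩
  rw [map_pow]
  change T h = _
  rw [← hLE, hh]
  exact hv

theorem power_inner_of_induced_finite_order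
    (H : Type*) [Group H]
    (hcyc : IsCyclic (Subgroup.center H)) (hinf : Infinite (Subgroup.center H))
    (hfree : ∃ n : ℕ, Nonempty ((H ⧸ Subgroup.center H) ≃* Multiplicative (Fin n → ℤ)))
    (f : MulAut H)
    (hford : ∃ k : ℕ, 0 < k ∧ ∀ x : H, x⁻¹ * (f ^ k) x ∈ Subgroup.center H) :
    ∃ m : ℕ, 0 < m ∧ ∃ h : H, ∀ x : H, (f ^ m) x = h * x * h⁻¹ := by
  obtain ⟨n, ⟨e⟩⟩ := hfree
  obtain ⟨k, hk, hfk⟩ := hford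
  have hc := commutator_mem_center_of_quotient_comm
    (e.toMonoidHom.comp (QuotientGroup.mk' (Subgroup.center H)))
    (by ext x; simp)
  have hg (x : H) : x⁻¹ * ((f ^ k) ^ 2) x ∈ Subgroup.center H := by
    have := mul_mem (hfk x) (hfk ((f ^ k) x))
    rwa [mul_assoc, mul_inv_cancel_left, ← MulAut.mul_apply, ← pow_two] at this
  have hz (z : H) (h : z ∈ Subgroup.center H) : ((f ^ k) ^ 2) z = z :=
    MulAut.sq_apply_of_mem_center hcyc hinf _ h
  obtain ⟨m, hm, h, hh⟩ := exists_commutatorHom_eq_pow hcyc hinf e hc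
    (MulAut.centralDisplacement _ hg) fun z h => by
      ext
      simp [MulAut.centralDisplacement, hz z h]
  refine ⟨k * 2 * m, by positivity, h, fun x => ?_⟩
  have hx : ⁅h, x⁆ = (MulAut.centralDisplacement _ hg x : H) ^ m := by
    simpa using congrArg Subtype.val (DFunLike.congr_fun hh x)
  rw [pow_mul, pow_mul, MulAut.pow_apply_eq_mul_centralDisplacement _ hg hz, ← hx,
    Subgroup.mem_center_iff.mp (hc h x) x, commutatorElement_def, inv_mul_cancel_right]
end

section
/- Let F be a countable locally finite group. Then the first group cohomology H¹(F; ℚ[F]) of F with coefficients in the group algebra ℚ[F], regarded as a representation of F via left multiplication, vanishes if and only if F is finite. -/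
open groupCohomology

/-- The first cohomology of a group vanishes iff every 1-cocycle is a 1-coboundary. -/
theorem subsingleton_groupCohomology_one_iff {k G : Type} [CommRing k] [Group G]
    (A : Rep k G) :
    Subsingleton (groupCohomology A 1) ↔
      ∀ f : G → A, (∀ g h : G, f (g * h) = A.ρ g (f h) + f g) →
        ∃ x : A, ∀ g : G, A.ρ g x - x = f g := by
  constructor
  · intro _ f hf
    have hc : f ∈ cocycles₁ A := (mem_cocycles₁_iff f).2 hf
    obtain ⟨x, hx⟩ := (H1π_eq_zero_iff (⟨f, hc⟩ : cocycles₁ A)).1 (Subsingleton.elim _ _)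
    exact ⟨x, fun g => congrFun hx g⟩
  · intro h
    refine ⟨fun a b => ?_⟩
    have key : ∀ a : H1 A, a = 0 := fun a => by
      induction a using H1_induction_on with
      | h f =>
        rw [H1π_eq_zero_iff]
        obtain ⟨x, hx⟩ := h f ((mem_cocycles₁_iff _).1 f.2)
        exact ⟨x, funext hx⟩
    exact (key a).trans (key b).symm

/-- Over a field of characteristic zero, 1-cocycles of a finite group are coboundaries, by
averaging. -/
theorem subsingleton_groupCohomology_one_of_finite {k G : Type} [Field k] [CharZero k] [Group G]
    [Finite G] (A : Rep k G) : Subsingleton (groupCohomology A 1) := by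
  rw [subsingleton_groupCohomology_one_iff]
  intro f hf
  have := Fintype.ofFinite G
  have hn : (Fintype.card G : k) ≠ 0 := Nat.cast_ne_zero.2 Fintype.card_ne_zero
  refine ⟨-((Fintype.card G : k)⁻¹ • ∑ h, f h), fun g => ?_⟩
  have hsum : ∑ h, f h = A.ρ g (∑ h, f h) + (Fintype.card G : k) • f g := by
    calc ∑ h, f h = ∑ h, f (g * h) := (Equiv.sum_comp (Equiv.mulLeft g) f).symm
      _ = _ := by simp [hf, Finset.sum_add_distrib, Nat.cast_smul_eq_nsmul]
  rw [map_neg, map_smul, neg_sub_neg, ← smul_sub, sub_eq_of_eq_add' hsum, smul_smul,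
    inv_mul_cancel₀ hn, one_smul]

/-- A function on `G` whose left translates differ from it by finitely supported functions is,
if `H¹(G; k[G])` vanishes, a finitely supported perturbation of a constant; in particular it has
finite range. -/
theorem finite_range_of_almost_invariant {k G : Type} [CommRing k] [Group G]
    [Subsingleton (groupCohomology (Rep.leftRegular k G) 1)] (φ : G → k)
    (hφ : ∀ g : G, {x | φ (g⁻¹ * x) ≠ φ x}.Finite) : (Set.range φ).Finite := by
  have hfin (g : G) : (Function.support fun x => φ (g⁻¹ * x) - φ x).Finite :=
    (hφ g).subset fun x hx => sub_ne_zero.1 hx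
  let f : G → MonoidAlgebra k G := fun g => .ofCoeff (Finsupp.ofSupportFinite _ (hfin g))
  have hf (g x : G) : (f g).coeff x = φ (g⁻¹ * x) - φ x := rfl
  obtain ⟨ψ, hψ⟩ := (subsingleton_groupCohomology_one_iff (Rep.leftRegular k G)).1 inferInstance f
    fun g h => by
      apply MonoidAlgebra.coeff_injective
      ext x
      change _ = ((Representation.leftRegular k G g (f h)) + f g).coeff x
      simp only [MonoidAlgebra.coeff_add, Finsupp.add_apply, Representation.coeff_ofMulAction, hf,
        smul_eq_mul, mul_inv_rev, mul_assoc]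
      ring
  change MonoidAlgebra k G at ψ
  have hconst (x : G) : φ x = ψ.coeff x + (φ 1 - ψ.coeff 1) := by
    have h : (Representation.leftRegular k G x ψ - ψ).coeff x = (f x).coeff x :=
      congrArg (fun y : MonoidAlgebra k G => y.coeff x) (hψ x)
    simp only [MonoidAlgebra.coeff_sub, Finsupp.sub_apply, Representation.coeff_ofMulAction, hf,
      smul_eq_mul, inv_mul_cancel] at h
    linear_combination h
  refine ((ψ.coeff.finite_range).image (· + (φ 1 - ψ.coeff 1))).subset ?_
  rintro _ ⟨x, rfl⟩
  exact ⟨_, ⟨x, rfl⟩, (hconst x).symm⟩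

/-- A countable locally finite group is an increasing union of finite subgroups. -/
theorem exists_monotone_finite_subgroups {F : Type} [Group F] [Countable F]
    (hlf : ∀ H : Subgroup F, H.FG → Finite H) :
    ∃ S : ℕ → Subgroup F, Monotone S ∧ (∀ n, Finite (S n)) ∧ ∀ x, ∃ n, x ∈ S n := by
  obtain ⟨e, he⟩ := exists_surjective_nat F
  refine ⟨fun n => Subgroup.closure (e '' Set.Iic n), fun m n hmn => ?_, fun n => ?_, fun x => ?_⟩
  · exact Subgroup.closure_mono (Set.image_mono (Set.Iic_subset_Iic.2 hmn))
  · exact hlf _ ((Subgroup.fg_iff _).2 ⟨_, rfl, (Set.finite_Iic n).image e⟩)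
  · obtain ⟨n, rfl⟩ := he x
    exact ⟨n, Subgroup.subset_closure ⟨n, Set.self_mem_Iic, rfl⟩⟩

theorem first_cohomology_group_algebra_vanishes_iff_finite
    (F : Type) [Group F] [Countable F]
    (hlf : ∀ H : Subgroup F, H.FG → Finite H) :
    Subsingleton (groupCohomology (Rep.leftRegular ℚ F) 1) ↔ Finite F := by
  refine ⟨fun _ => ?_, fun _ => subsingleton_groupCohomology_one_of_finite _⟩
  obtain ⟨S, hmono, hfin, hS⟩ := exists_monotone_finite_subgroups hlf
  let level : F → ℕ := fun x => sInf {n | x ∈ S n}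
  have hlevel (x : F) : x ∈ S (level x) := Nat.sInf_mem (hS x)
  have hinv (g : F) : {x | (level (g⁻¹ * x) : ℚ) ≠ level x}.Finite := by
    obtain ⟨m, hm⟩ := hS g
    refine (Set.toFinite (S m : Set F)).subset fun x hx => ?_
    by_contra hxm
    refine hx (congrArg (fun s : Set ℕ => ((sInf s : ℕ) : ℚ)) (Set.ext fun n => ?_))
    rcases le_total m n with h | h
    · exact (S n).mul_mem_cancel_left ((S n).inv_mem (hmono h hm))
    · refine iff_of_false (fun hn => hxm ?_) fun hn => hxm (hmono h hn)
      exact ((S m).mul_mem_cancel_left ((S m).inv_mem hm)).1 (hmono h hn)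
  have hrange : (Set.range level).Finite := by
    refine Set.Finite.of_finite_image (f := ((↑) : ℕ → ℚ)) ?_ Nat.cast_injective.injOn
    rw [← Set.range_comp]
    exact finite_range_of_almost_invariant _ hinv
  obtain ⟨N, hN⟩ := hrange.bddAbove
  exact Set.finite_univ_iff.1 ((Set.toFinite (S N : Set F)).subset fun x _ =>
    hmono (hN ⟨x, rfl⟩) (hlevel x))
end

section
/- Let F be a countable locally finite group. Then H^k(F; M) = 0 for every integer k ≥ 2 and every ℚ-linear representation M of F. (Equivalently, the cohomological dimension of F over ℚ is at most 1.) -/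
open CategoryTheory

universe u

section ContractNth

variable {α : Type*} {n : ℕ} (op : α → α → α) (g : Fin (n + 1) → α) (a : α)

theorem Fin.contractNth_last :
    Fin.contractNth (Fin.last n) op g = Fin.init (α := fun _ => α) g := by
  funext i
  rw [Fin.contractNth_apply_of_lt _ _ _ _ (by simp)]
  rfl

/-- Contracting two entries before the last one commutes with appending an entry. -/
theorem Fin.contractNth_castSucc_castSucc_snoc (j : Fin n) :
    Fin.contractNth j.castSucc.castSucc op (Fin.snoc (α := fun _ => α) g a) =
      Fin.snoc (α := fun _ => α) (Fin.contractNth j.castSucc op g) a := by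
  funext i
  refine Fin.lastCases ?_ (fun i => ?_) i
  · rw [Fin.contractNth_apply_of_gt _ _ _ _ (by simp)]
    simp
  · simp only [Fin.contractNth, Fin.snoc_castSucc, Fin.val_castSucc, Fin.succ_castSucc]

/-- Contracting the appended entry with its predecessor. -/
theorem Fin.contractNth_castSucc_last_snoc :
    Fin.contractNth (Fin.last n).castSucc op (Fin.snoc (α := fun _ => α) g a) =
      Fin.snoc (α := fun _ => α) (Fin.init (α := fun _ => α) g) (op (g (Fin.last n)) a) := by
  funext i
  refine Fin.lastCases ?_ (fun i => ?_) i
  · rw [Fin.contractNth_apply_of_eq _ _ _ _ (by simp)]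
    simp
  · rw [Fin.contractNth_apply_of_lt _ _ _ _ (by simp)]
    simp [Fin.init]

theorem Fin.contractNth_mem {G S : Type*} [Mul G] [SetLike S G] [MulMemClass S G] {H : S} {n : ℕ}
    {g : Fin (n + 1) → G} (hg : ∀ i, g i ∈ H) (j : Fin (n + 1)) (i : Fin n) :
    Fin.contractNth j (· * ·) g i ∈ H := by
  unfold Fin.contractNth
  split_ifs
  · exact hg _
  · exact mul_mem (hg _) (hg _)
  · exact hg _

end ContractNth

namespace groupCohomology

section Differential

variable {k G : Type u} [CommRing k] [Group G]

/-- The value of `d f` on `g` only depends on `f` on a subgroup containing the entries of `g`. -/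
theorem d_apply_congr (A : Rep.{u} k G) {n : ℕ} {H : Subgroup G} {f f' : (Fin n → G) → A}
    (h : ∀ g : Fin n → G, (∀ i, g i ∈ H) → f g = f' g)
    {g : Fin (n + 1) → G} (hg : ∀ i, g i ∈ H) :
    (inhomogeneousCochains.d A n).hom f g = (inhomogeneousCochains.d A n).hom f' g := by
  rw [inhomogeneousCochains.d_hom_apply, inhomogeneousCochains.d_hom_apply, h _ fun i => hg _]
  congr 1
  exact Finset.sum_congr rfl fun j _ => by rw [h _ (Fin.contractNth_mem hg j)]

theorem d_d_apply (A : Rep.{u} k G) {n : ℕ} (f : (Fin n → G) → A) :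
    (inhomogeneousCochains.d A (n + 1)).hom ((inhomogeneousCochains.d A n).hom f) = 0 :=
  LinearMap.congr_fun (ModuleCat.hom_ext_iff.1 (inhomogeneousCochains.d_comp_d n A)) f

/-- The sum of a cochain over the values of its last variable in a finite subgroup. -/
def sumLast (A : Rep.{u} k G) (H : Subgroup G) [Fintype H] {n : ℕ} (f : (Fin (n + 1) → G) → A)
    (g : Fin n → G) : A :=
  ∑ h : H, f (Fin.snoc (α := fun _ => G) g h)

theorem d_sumLast (A : Rep.{u} k G) (H : Subgroup G) [Fintype H] {n : ℕ}
    {f : (Fin (n + 1) → G) → A} {g : Fin (n + 1) → G} (hg : ∀ i, g i ∈ H) :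
    (inhomogeneousCochains.d A n).hom (sumLast A H f) g =
      ∑ h : H, (inhomogeneousCochains.d A (n + 1)).hom f (Fin.snoc (α := fun _ => G) g h) +
        (-1 : k) ^ (n + 1) • (Fintype.card H : k) • f g := by
  have key : ∀ h : H,
      (inhomogeneousCochains.d A (n + 1)).hom f (Fin.snoc (α := fun _ => G) g h) =
      A.ρ (g 0) (f (Fin.snoc (α := fun _ => G) (fun i => g i.succ) h)) +
      (∑ j : Fin n, (-1 : k) ^ ((j : ℕ) + 1) •
        f (Fin.snoc (α := fun _ => G) (Fin.contractNth j.castSucc (· * ·) g) h)) +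
      (-1 : k) ^ (n + 1) •
        f (Fin.snoc (α := fun _ => G) (Fin.init (α := fun _ => G) g) (g (Fin.last n) * h)) -
      (-1 : k) ^ (n + 1) • f g := by
    intro h
    have h0 : (Fin.snoc (α := fun _ => G) g (h : G) : Fin (n + 2) → G) 0 = g 0 :=
      Fin.snoc_castSucc (α := fun _ => G) (h : G) g 0
    have h1 : (fun i : Fin (n + 1) => (Fin.snoc (α := fun _ => G) g (h : G) : Fin (n + 2) → G)
        i.succ) = Fin.snoc (α := fun _ => G) (fun i => g i.succ) (h : G) := by
      funext i
      refine Fin.lastCases ?_ (fun i => ?_) i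
      · simp
      · rw [Fin.succ_castSucc, Fin.snoc_castSucc, Fin.snoc_castSucc]
    rw [inhomogeneousCochains.d_hom_apply, Fin.sum_univ_castSucc, Fin.sum_univ_castSucc, h0, h1,
      Fin.contractNth_castSucc_last_snoc, Fin.contractNth_last, Fin.init_snoc]
    simp only [Fin.contractNth_castSucc_castSucc_snoc, Fin.val_castSucc, Fin.val_last]
    rw [pow_succ (-1 : k) (n + 1), mul_neg_one, neg_smul]
    abel
  have shift : ∑ h : H, f (Fin.snoc (α := fun _ => G) (Fin.init (α := fun _ => G) g)
      (g (Fin.last n) * h)) = sumLast A H f (Fin.init (α := fun _ => G) g) :=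
    Fintype.sum_equiv (Equiv.mulLeft (⟨g (Fin.last n), hg _⟩ : H)) _ _ fun h => rfl
  simp only [key, Finset.sum_sub_distrib, Finset.sum_add_distrib, ← Finset.smul_sum, shift]
  rw [inhomogeneousCochains.d_hom_apply, Fin.sum_univ_castSucc, Fin.contractNth_last,
    Finset.sum_comm]
  simp only [sumLast, map_sum, Finset.smul_sum, Finset.sum_const, Finset.card_univ,
    Fin.val_castSucc, Fin.val_last, Nat.cast_smul_eq_nsmul]
  abel

end Differential

variable {k G : Type u} [Field k] [CharZero k] [Group G] (A : Rep.{u} k G)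

/-- A cochain of positive degree that is closed on a finite subgroup is exact there. -/
theorem exists_d_eq_of_finite (H : Subgroup G) [Finite H] {n : ℕ} {f : (Fin (n + 1) → G) → A}
    (hf : ∀ g, (∀ i, g i ∈ H) → (inhomogeneousCochains.d A (n + 1)).hom f g = 0) :
    ∃ b : (Fin n → G) → A, ∀ g, (∀ i, g i ∈ H) → (inhomogeneousCochains.d A n).hom b g = f g := by
  have := Fintype.ofFinite H
  have hc : (-1 : k) ^ (n + 1) * (Fintype.card H : k) ≠ 0 := by simp
  refine ⟨((-1 : k) ^ (n + 1) * (Fintype.card H : k))⁻¹ • sumLast A H f, fun g hg => ?_⟩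
  rw [map_smul, Pi.smul_apply, d_sumLast A H hg, Finset.sum_eq_zero, zero_add, smul_smul,
    smul_smul, mul_assoc, inv_mul_cancel₀ hc, one_smul]
  intro h _
  exact hf _ fun i => Fin.lastCases (by simp) (fun i => by simpa using hg i) i

/-- A primitive on a finite subgroup of a closed cochain of degree at least two
extends to a primitive on any larger finite subgroup. -/
theorem exists_d_eq_extending {H K : Subgroup G} [Finite H] [Finite K] (hHK : H ≤ K) {n : ℕ}
    {f : (Fin (n + 2) → G) → A} (hf : (inhomogeneousCochains.d A (n + 2)).hom f = 0)
    {b : (Fin (n + 1) → G) → A}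
    (hb : ∀ g, (∀ i, g i ∈ H) → (inhomogeneousCochains.d A (n + 1)).hom b g = f g) :
    ∃ b' : (Fin (n + 1) → G) → A,
      (∀ g, (∀ i, g i ∈ K) → (inhomogeneousCochains.d A (n + 1)).hom b' g = f g) ∧
        ∀ g, (∀ i, g i ∈ H) → b' g = b g := by
  obtain ⟨c, hc⟩ := exists_d_eq_of_finite A K (f := f) fun g _ => congr_fun hf g
  obtain ⟨e, he⟩ := exists_d_eq_of_finite A H (f := c - b) fun g hg => by
    rw [map_sub, Pi.sub_apply, hc g fun i => hHK (hg i), hb g hg, sub_self]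
  refine ⟨c - (inhomogeneousCochains.d A n).hom e, fun g hg => ?_, fun g hg => ?_⟩
  · rw [map_sub, d_d_apply, sub_zero, hc g hg]
  · rw [Pi.sub_apply, he g hg, Pi.sub_apply, sub_sub_cancel]

/-- Closed cochains of degree at least two on an increasing union of finite subgroups are exact. -/
theorem exists_d_eq_of_iUnion_finite {H : ℕ → Subgroup G} (hH : Monotone H)
    (hfin : ∀ m, Finite (H m)) (hcov : ∀ x, ∃ m, x ∈ H m) {n : ℕ} {f : (Fin (n + 2) → G) → A}
    (hf : (inhomogeneousCochains.d A (n + 2)).hom f = 0) :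
    ∃ b : (Fin (n + 1) → G) → A, (inhomogeneousCochains.d A (n + 1)).hom b = f := by
  have hcov' : ∀ {l : ℕ} (g : Fin l → G), ∃ m, ∀ i, g i ∈ H m := fun g => by
    choose m hm using fun i => hcov (g i)
    exact ⟨Finset.univ.sup m, fun i => hH (Finset.le_sup (Finset.mem_univ i)) (hm i)⟩
  let P (m : ℕ) : Type u := {b : (Fin (n + 1) → G) → A //
    ∀ g, (∀ i, g i ∈ H m) → (inhomogeneousCochains.d A (n + 1)).hom b g = f g}
  have step (m : ℕ) (b : P m) :
      ∃ b' : P (m + 1), ∀ g, (∀ i, g i ∈ H m) → b'.1 g = b.1 g := by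
    obtain ⟨b', h, h'⟩ := exists_d_eq_extending A (hH m.le_succ) hf b.2
    exact ⟨⟨b', h⟩, h'⟩
  choose next hnext using step
  obtain ⟨b₀, hb₀⟩ := exists_d_eq_of_finite A (H 0) (f := f) fun g _ => congr_fun hf g
  let b : ∀ m, P m := fun m => Nat.rec ⟨b₀, hb₀⟩ next m
  have hb {m l : ℕ} (hml : m ≤ l) (g : Fin (n + 1) → G) (hg : ∀ i, g i ∈ H m) :
      (b l).1 g = (b m).1 g := by
    induction l, hml using Nat.le_induction with
    | base => rfl
    | succ l hml ih => exact (hnext l (b l) g fun i => hH hml (hg i)).trans ih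
  choose N hN using fun g : Fin (n + 1) → G => hcov' g
  refine ⟨fun g => (b (N g)).1 g, funext fun g => ?_⟩
  obtain ⟨m, hm⟩ := hcov' g
  rw [← (b m).2 g hm]
  refine d_apply_congr A (fun g hg => ?_) hm
  rcases le_total (N g) m with h | h
  · exact (hb h g (hN g)).symm
  · exact hb h g hg

theorem subsingleton_of_forall_exists_d_eq {R : Type u} [CommRing R] (B : Rep.{u} R G) {n : ℕ}
    (h : ∀ f : (Fin (n + 1) → G) → B, (inhomogeneousCochains.d B (n + 1)).hom f = 0 →
      ∃ b : (Fin n → G) → B, (inhomogeneousCochains.d B n).hom b = f) :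
    Subsingleton (groupCohomology B (n + 1)) := by
  refine ModuleCat.subsingleton_of_isZero ?_
  refine ((inhomogeneousCochains B).exactAt_iff_isZero_homology (n + 1)).1 ?_
  rw [(inhomogeneousCochains B).exactAt_iff' n (n + 1) (n + 2) (by simp) (by simp),
    ShortComplex.moduleCat_exact_iff]
  intro f hf
  have d_hom (m : ℕ) : ((inhomogeneousCochains B).d m (m + 1)).hom =
      (inhomogeneousCochains.d B m).hom :=
    congr_arg ModuleCat.Hom.hom (inhomogeneousCochains.d_def B m)
  obtain ⟨b, hb⟩ := h f ((LinearMap.congr_fun (d_hom (n + 1)) f).symm.trans hf)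
  exact ⟨b, (LinearMap.congr_fun (d_hom n) b).trans hb⟩

end groupCohomology

theorem exists_monotone_fg_subgroup_cover (G : Type*) [Group G] [Countable G] :
    ∃ H : ℕ → Subgroup G, Monotone H ∧ (∀ m, (H m).FG) ∧ ∀ x, ∃ m, x ∈ H m := by
  obtain ⟨e, he⟩ := exists_surjective_nat G
  refine ⟨fun m => Subgroup.closure (e '' Set.Iic m), fun m l hml => ?_, fun m => ?_, fun x => ?_⟩
  · exact Subgroup.closure_mono (Set.image_mono (Set.Iic_subset_Iic.2 hml))
  · exact (Subgroup.fg_iff _).2 ⟨_, rfl, (Set.finite_Iic m).image e⟩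
  · obtain ⟨m, rfl⟩ := he x
    exact ⟨m, Subgroup.subset_closure ⟨m, Set.self_mem_Iic, rfl⟩⟩

theorem locally_finite_rational_cd_le_one
    (F : Type) [Group F] [Countable F]
    (hlf : ∀ H : Subgroup F, H.FG → Finite H) :
    ∀ k : ℕ, 2 ≤ k → ∀ M : Rep ℚ F, Subsingleton (groupCohomology M k) := by
  intro k hk M
  obtain ⟨n, rfl⟩ := Nat.exists_eq_add_of_le' hk
  obtain ⟨H, hH, hfg, hcov⟩ := exists_monotone_fg_subgroup_cover F
  exact groupCohomology.subsingleton_of_forall_exists_d_eq M fun f hf =>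
    groupCohomology.exists_d_eq_of_iUnion_finite M hH (fun m => hlf _ (hfg m)) hcov hf
end

section
/- Let G be a countable group that is locally virtually cyclic (every finitely generated subgroup of G is virtually cyclic) but not locally finite (some finitely generated subgroup of G is infinite). Suppose that H^k(G; M) = 0 for every integer k ≥ 2 and every ℚ-linear representation M of G (i.e. the cohomological dimension of G over ℚ is at most 1). Then G is virtually cyclic. -/
section FreePermutationModule

variable {G X : Type*} [Group G] [MulAction G X]

/-- The permutation representation of `G` on the finitely supported functions `X →₀ ℚ`. -/
noncomputable def permRep (G X : Type*) [Group G] [MulAction G X] :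
    Representation ℚ G (X →₀ ℚ) where
  toFun g := Finsupp.lmapDomain ℚ ℚ (g • ·)
  map_one' := by ext; simp
  map_mul' g h := by ext; simp [mul_smul]

@[simp]
lemma permRep_single (g : G) (x : X) (r : ℚ) :
    permRep G X g (Finsupp.single x r) = Finsupp.single (g • x) r := by
  simp [permRep]

open Classical in
/-- The sum of the values of a finitely supported function over the `⟨z⟩`-orbit of `x`. -/
noncomputable def orbitSum (z : G) (x : X) : (X →₀ ℚ) →ₗ[ℚ] ℚ :=
  Finsupp.linearCombination ℚ fun y ↦ if ∃ k : ℤ, z ^ k • x = y then 1 else 0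

open Classical in
lemma orbitSum_single (z : G) (x y : X) (r : ℚ) :
    orbitSum z x (Finsupp.single y r) = if ∃ k : ℤ, z ^ k • x = y then r else 0 := by
  simp [orbitSum]

lemma exists_mem_support_of_orbitSum_ne_zero {z : G} {x : X} {f : X →₀ ℚ}
    (h : orbitSum z x f ≠ 0) : ∃ y ∈ f.support, ∃ k : ℤ, z ^ k • x = y := by
  classical
  contrapose! h
  rw [orbitSum, Finsupp.linearCombination_apply]
  refine Finset.sum_eq_zero fun y hy ↦ ?_
  simp [h y hy]

lemma orbitSum_permRep_zpow (z : G) (x : X) (n : ℤ) (f : X →₀ ℚ) :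
    orbitSum z x (permRep G X (z ^ n) f) = orbitSum z x f := by
  classical
  induction f using Finsupp.induction_linear with
  | zero => simp
  | add f g hf hg => simp [hf, hg]
  | single y r =>
    rw [permRep_single, orbitSum_single, orbitSum_single]
    congr 1
    refine propext ⟨fun ⟨k, hk⟩ ↦ ⟨k - n, ?_⟩, fun ⟨k, hk⟩ ↦ ⟨n + k, ?_⟩⟩
    · rw [sub_eq_neg_add, zpow_add, mul_smul, hk, zpow_neg, inv_smul_smul]
    · rw [zpow_add, mul_smul, hk]

/-- Elements normalizing `⟨w⟩` (by acting as `±1`) permute the `⟨w⟩`-orbits. -/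
lemma orbitSum_smul_permRep {g w : G} {ε : ℤ} (hε : ε * ε = 1) (hg : g * w = w ^ ε * g)
    (x : X) (f : X →₀ ℚ) :
    orbitSum w (g • x) (permRep G X g f) = orbitSum w x f := by
  classical
  have hconj (k : ℤ) : g * w ^ k = w ^ (ε * k) * g := by
    have h : SemiconjBy g w (w ^ ε) := hg
    rw [zpow_mul]
    exact h.zpow_right k
  induction f using Finsupp.induction_linear with
  | zero => simp
  | add f g hf hg => simp [hf, hg]
  | single y r =>
    rw [permRep_single, orbitSum_single, orbitSum_single]
    congr 1
    refine propext ⟨fun ⟨k, hk⟩ ↦ ⟨ε * k, ?_⟩, fun ⟨k, hk⟩ ↦ ⟨ε * k, ?_⟩⟩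
    · rw [← smul_left_cancel_iff g, ← mul_smul, hconj, ← mul_assoc, hε, one_mul, mul_smul, hk]
    · rw [← mul_smul, ← hconj, mul_smul, hk]

/-- A `⟨z⟩`-orbit is the disjoint union of its translates of a `⟨z ^ m⟩`-orbit. -/
lemma sum_orbitSum_pow [IsCancelSMul G X] {z : G} (hz : ¬ IsOfFinOrder z) {m : ℕ} (hm : 0 < m)
    (x : X) (f : X →₀ ℚ) :
    ∑ i ∈ Finset.range m, orbitSum (z ^ m) x (permRep G X (z ^ i) f) = orbitSum z x f := by
  classical
  induction f using Finsupp.induction_linear with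
  | zero => simp
  | add f g hf hg => simp only [map_add, hf, hg, Finset.sum_add_distrib]
  | single y r =>
    simp only [permRep_single, orbitSum_single]
    split_ifs with h
    · obtain ⟨k, rfl⟩ := h
      have key (i : ℕ) : (∃ l : ℤ, (z ^ m) ^ l • x = z ^ i • z ^ k • x) ↔ (m : ℤ) ∣ i + k := by
        have : ∀ l : ℤ, (z ^ m) ^ l • x = z ^ i • z ^ k • x ↔ m * l = i + k := fun l ↦ by
          rw [← mul_smul, ← zpow_natCast, ← zpow_natCast, ← zpow_mul, ← zpow_add]
          refine ⟨fun h ↦ ?_, fun h ↦ by rw [h]⟩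
          exact (injective_zpow_iff_not_isOfFinOrder.2 hz) (IsCancelSMul.right_cancel _ _ _ h)
        simp only [this, Dvd.dvd, eq_comm]
      simp only [key]
      have hm' : (0 : ℤ) < m := by exact_mod_cast hm
      rw [Finset.sum_eq_single ((-k) % m).toNat]
      · rw [if_pos]
        rw [Int.toNat_of_nonneg (Int.emod_nonneg _ hm'.ne')]
        have := Int.emod_add_mul_ediv (-k) m
        exact ⟨-((-k) / m), by linarith⟩
      · intro i hi hne
        rw [if_neg]
        intro hdvd
        apply hne
        have h1 : (i : ℤ) % m = (-k) % m :=
          Int.ModEq.symm ((Int.modEq_iff_dvd).2 (by simpa using hdvd))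
        rw [Int.emod_eq_of_lt (by positivity) (by exact_mod_cast Finset.mem_range.1 hi)] at h1
        rw [← h1, Int.toNat_natCast]
      · intro hnot
        refine absurd (Finset.mem_range.2 ?_) hnot
        have := Int.emod_lt_of_pos (-k) hm'
        have := Int.emod_nonneg (-k) hm'.ne'
        omega
    · refine Finset.sum_eq_zero fun i _ ↦ if_neg fun ⟨l, hl⟩ ↦ h ⟨m * l - i, ?_⟩
      rw [sub_eq_neg_add, zpow_add, mul_smul, zpow_mul, zpow_natCast, hl, zpow_neg, zpow_natCast,
        inv_smul_smul]

/-- A function all of whose `⟨z⟩`-orbit sums vanish is of the form `z • f - f`. -/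
lemma exists_permRep_sub_eq_of_orbitSum_eq_zero {z : G} {f : X →₀ ℚ}
    (hf : ∀ x, orbitSum z x f = 0) : ∃ f', permRep G X z f' - f' = f := by
  classical
  let r (x : X) : X :=
    Quotient.out (Quotient.mk (MulAction.orbitRel (Subgroup.zpowers z) X) x)
  have hr (x : X) : ∃ k : ℤ, z ^ k • r x = x := by
    obtain ⟨⟨_, k, rfl⟩, hk⟩ := (MulAction.orbitRel (Subgroup.zpowers z) X).symm
      (Quotient.mk_out (s := MulAction.orbitRel (Subgroup.zpowers z) X) x)
    exact ⟨k, hk⟩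
  have hr' (x : X) (k : ℤ) : r (z ^ k • x) = r x := by
    refine congrArg Quotient.out (Quotient.sound' ?_)
    exact (MulAction.orbitRel_apply ..).2 ⟨⟨z ^ k, k, rfl⟩, rfl⟩
  have hrange (k : ℤ) (v : X →₀ ℚ) :
      permRep G X (z ^ k) v - v ∈ LinearMap.range (permRep G X z - LinearMap.id) := by
    induction k generalizing v with
    | zero => simp
    | succ n ih =>
      have : permRep G X (z ^ (n + 1 : ℤ)) v - v =
          (permRep G X (z ^ (n : ℤ)) (permRep G X z v) - permRep G X z v) +
            (permRep G X z v - v) := by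
        rw [zpow_add_one, map_mul]; simp
      rw [this]
      exact add_mem (ih _) ⟨v, rfl⟩
    | pred n ih =>
      have : permRep G X (z ^ (-n - 1 : ℤ)) v - v =
          (permRep G X (z ^ (-n : ℤ)) (permRep G X z⁻¹ v) - permRep G X z⁻¹ v) -
            (permRep G X z (permRep G X z⁻¹ v) - permRep G X z⁻¹ v) := by
        rw [zpow_sub_one, map_mul, ← Module.End.mul_apply (permRep G X z), ← map_mul]; simp
      rw [this]
      exact sub_mem (ih _) ⟨_, rfl⟩
  have hmem (v : X →₀ ℚ) :
      v - Finsupp.lmapDomain ℚ ℚ r v ∈ LinearMap.range (permRep G X z - LinearMap.id) := by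
    induction v using Finsupp.induction_linear with
    | zero => simp
    | add v w hv hw =>
      rw [map_add, add_sub_add_comm]
      exact add_mem hv hw
    | single x c =>
      obtain ⟨k, hk⟩ := hr x
      have := hrange k (Finsupp.single (r x) c)
      simpa [hk] using this
  have hval (v : X →₀ ℚ) (y : X) :
      Finsupp.lmapDomain ℚ ℚ r v y = if r y = y then orbitSum z y v else 0 := by
    induction v using Finsupp.induction_linear with
    | zero => simp
    | add v w hv hw => rw [map_add, Finsupp.add_apply, hv, hw]; split_ifs <;> simp
    | single x c =>
      simp only [Finsupp.lmapDomain_apply, Finsupp.mapDomain_single, orbitSum_single,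
        Finsupp.single_apply]
      rw [← ite_and]
      congr 1
      refine propext ⟨fun h ↦ ?_, fun ⟨h, k, hk⟩ ↦ ?_⟩
      · obtain ⟨k, hk⟩ := hr x
        rw [h] at hk
        exact ⟨by rw [← hr' y k, hk, h], k, hk⟩
      · rw [← hk, hr', h]
  have hzero : Finsupp.lmapDomain ℚ ℚ r f = 0 := by
    ext y
    rw [hval, hf, ite_self, Finsupp.zero_apply]
  simpa [hzero] using hmem f

/-- In a free permutation module, only `0` is fixed by an element of infinite order. -/
lemma eq_zero_of_permRep_eq_self [IsCancelSMul G X] {z : G} (hz : ¬ IsOfFinOrder z)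
    {f : X →₀ ℚ} (hf : permRep G X z f = f) : f = 0 := by
  classical
  have hshift (x : X) : f (z • x) = f x := by
    conv_lhs => rw [← hf]
    exact Finsupp.mapDomain_apply (MulAction.injective z) f x
  have hpow (n : ℕ) (x : X) : f (z ^ n • x) = f x := by
    induction n with
    | zero => simp
    | succ n ih => rw [pow_succ', mul_smul, hshift, ih]
  ext x
  by_contra hx
  refine Set.infinite_of_injective_forall_mem (f := fun n : ℕ ↦ z ^ n • x)
    (fun a b hab ↦ ?_) (fun n ↦ ?_) f.support.finite_toSet
  · exact (injective_pow_iff_not_isOfFinOrder.2 hz) (IsCancelSMul.right_cancel _ _ _ hab)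
  · simpa [hpow] using hx

section Derivation

variable {D : G → X →₀ ℚ}

lemma derivation_one (hD : ∀ g h, D (g * h) = permRep G X g (D h) + D g) : D 1 = 0 := by
  simpa using hD 1 1

lemma derivation_pow (hD : ∀ g h, D (g * h) = permRep G X g (D h) + D g)
    (z : G) (m : ℕ) :
    D (z ^ m) = ∑ i ∈ Finset.range m, permRep G X (z ^ i) (D z) := by
  induction m with
  | zero => simpa using derivation_one hD
  | succ m ih => rw [pow_succ, hD, ih, Finset.sum_range_succ, add_comm]

lemma orbitSum_derivation_pow [IsCancelSMul G X]
    (hD : ∀ g h, D (g * h) = permRep G X g (D h) + D g)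
    {z : G} (hz : ¬ IsOfFinOrder z) {m : ℕ} (hm : 0 < m) (x : X) :
    orbitSum (z ^ m) x (D (z ^ m)) = orbitSum z x (D z) := by
  rw [derivation_pow hD, map_sum, sum_orbitSum_pow hz hm]

/-- If `g` conjugates a power of `z` to itself or its inverse, the orbit sums of `D z` over the
`⟨z⟩`-orbits of `x` and `g • x` agree up to sign. -/
lemma orbitSum_derivation_smul_ne_zero [IsCancelSMul G X]
    (hD : ∀ g h, D (g * h) = permRep G X g (D h) + D g)
    {z g : G} (hz : ¬ IsOfFinOrder z) {m : ℕ} (hm : 0 < m) {ε : ℤ} (hε : ε * ε = 1)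
    (hg : g * z ^ m = (z ^ m) ^ ε * g) {x : X} (hx : orbitSum z x (D z) ≠ 0) : orbitSum z (g • x) (D z) ≠ 0 := by
  rw [← orbitSum_derivation_pow hD hz hm] at hx ⊢
  generalize z ^ m = w at *
  have h := congrArg (orbitSum w (g • x)) ((hD g w).symm.trans ((congrArg D hg).trans (hD _ g)))
  rw [map_add, map_add, orbitSum_permRep_zpow, orbitSum_smul_permRep hε hg,
    add_comm, add_right_inj] at h
  rcases mul_self_eq_one_iff.1 hε with rfl | rfl
  · rw [zpow_one] at h
    rwa [← h]
  · have hinv := congrArg (orbitSum w (g • x)) (hD (w ^ (-1 : ℤ)) w)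
    rw [map_add, orbitSum_permRep_zpow, zpow_neg_one, inv_mul_cancel, derivation_one hD,
      map_zero] at hinv
    rw [zpow_neg_one] at h
    intro h0
    rw [h0, zero_add] at hinv
    exact hx (h.trans hinv.symm)

/-- If every element of `G` conjugates some power of `z` to itself or its inverse, and `G` has a
derivation into a free permutation module that is not inner on `⟨z⟩`, then `⟨z⟩` has finite
index. -/
lemma finiteIndex_zpowers_of_derivation [IsCancelSMul G X]
    (hD : ∀ g h, D (g * h) = permRep G X g (D h) + D g)
    {z : G} (hz : ¬ IsOfFinOrder z)
    (hconj : ∀ g : G, ∃ m : ℕ, 0 < m ∧ ∃ ε : ℤ, ε * ε = 1 ∧ g * z ^ m = (z ^ m) ^ ε * g)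
    (hinner : ∀ f, permRep G X z f - f ≠ D z) : (Subgroup.zpowers z).FiniteIndex := by
  obtain ⟨x, hx⟩ : ∃ x, orbitSum z x (D z) ≠ 0 := by
    by_contra! h
    obtain ⟨f, hf⟩ := exists_permRep_sub_eq_of_orbitSum_eq_zero h
    exact hinner f hf
  have hsupp (g : G) : ∃ y : (D z).support, ∃ k : ℤ, z ^ k • g • x = y := by
    obtain ⟨m, hm, ε, hε, hg⟩ := hconj g
    obtain ⟨y, hy, hk⟩ := exists_mem_support_of_orbitSum_ne_zero
      (orbitSum_derivation_smul_ne_zero hD hz hm hε hg hx)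
    exact ⟨⟨y, hy⟩, hk⟩
  choose y k hk using hsupp
  have hinj : Function.Injective fun q : G ⧸ Subgroup.zpowers z ↦ y q.out⁻¹ := by
    intro p q hpq
    have h := (hk p.out⁻¹).trans ((congrArg Subtype.val hpq).trans (hk q.out⁻¹).symm)
    rw [← mul_smul, ← mul_smul] at h
    have h := IsCancelSMul.right_cancel _ _ _ h
    rw [← p.out_eq', ← q.out_eq', QuotientGroup.eq]
    refine ⟨-k p.out⁻¹ + k q.out⁻¹, ?_⟩
    change z ^ (-k p.out⁻¹ + k q.out⁻¹) = p.out⁻¹ * q.out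
    rw [zpow_add, zpow_neg, inv_mul_eq_iff_eq_mul, ← mul_assoc, h, inv_mul_cancel_right]
  have := Finite.of_injective _ hinj
  exact Subgroup.finiteIndex_of_finite_quotient

end Derivation

end FreePermutationModule

/-- If `z` has infinite order in a virtually cyclic group, every `g` conjugates some power of `z`
to itself or its inverse. -/
lemma IsVirtuallyCyclic.exists_conj_pow {H : Type*} [Group H] (hH : IsVirtuallyCyclic H) {z : H}
    (hz : ¬ IsOfFinOrder z) (g : H) :
    ∃ m : ℕ, 0 < m ∧ ∃ ε : ℤ, ε * ε = 1 ∧ g * z ^ m = (z ^ m) ^ ε * g := by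
  obtain ⟨C, hC, hfin⟩ := hH
  have hcyc : IsCyclic C.normalCore :=
    isCyclic_of_injective (Subgroup.inclusion C.normalCore_le) (Subgroup.inclusion_injective _)
  obtain ⟨n, hn⟩ := (Subgroup.isCyclic_iff_exists_zpowers_eq_top _).1 hcyc
  have hnormal : (Subgroup.zpowers n).Normal := hn ▸ C.normalCore_normal
  have hindex : (Subgroup.zpowers n).index ≠ 0 := by
    rw [hn]
    exact Subgroup.FiniteIndex.index_ne_zero
  obtain ⟨m, hm, -, b, hb⟩ := Subgroup.exists_pow_mem_of_index_ne_zero hindex z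
  have hb : n ^ b = z ^ m := hb
  have hn_inf : ¬ IsOfFinOrder n := fun h ↦ by
    have : IsOfFinOrder (z ^ m) := hb ▸ h.zpow
    exact hz ((isOfFinOrder_pow.1 this).resolve_right hm.ne')
  obtain ⟨s, hs⟩ := hnormal.conj_mem n (Subgroup.mem_zpowers n) g
  obtain ⟨t, ht⟩ := hnormal.conj_mem n (Subgroup.mem_zpowers n) g⁻¹
  have hs : n ^ s = g * n * g⁻¹ := hs
  have ht : n ^ t = g⁻¹ * n * g⁻¹⁻¹ := ht
  have hst : s * t = 1 := by
    apply injective_zpow_iff_not_isOfFinOrder.2 hn_inf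
    change n ^ (s * t) = n ^ (1 : ℤ)
    rw [zpow_mul, hs, conj_zpow, ht]
    group
  have hss : s * s = 1 := by
    rcases Int.isUnit_iff.1 (IsUnit.of_mul_eq_one _ hst) with rfl | rfl <;> rfl
  refine ⟨m, hm, s, hss, ?_⟩
  rw [← hb, ← zpow_mul, mul_comm b s, zpow_mul, hs, conj_zpow]
  group

open groupCohomology in
/-- A `2`-cocycle is a coboundary when `H²` vanishes. -/
lemma exists_of_subsingleton_H2 {G : Type} [Group G] {M : Rep ℚ G}
    (hM : Subsingleton (groupCohomology M 2)) (c : G × G → M)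
    (hc : ∀ g h j, c (g * h, j) + c (g, h) = M.ρ g (c (h, j)) + c (g, h * j)) :
    ∃ b : G → M, ∀ g h, M.ρ g (b h) - b (g * h) + b g = c (g, h) := by
  obtain ⟨b, hb⟩ := (H2π_eq_zero_iff ⟨c, (mem_cocycles₂_iff c).2 hc⟩).1 (hM.elim _ _)
  exact ⟨b, fun g h ↦ congrFun hb (g, h)⟩

instance isCancelSMul_prod {G : Type*} [Group G] : IsCancelSMul G (G × G) where
  right_cancel' _ _ _ h := mul_right_cancel (congrArg Prod.fst h)

/-- The boundary map `(a, b) ↦ b - a` of the homogeneous bar resolution. -/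
noncomputable def barBoundary (G : Type*) : (G × G →₀ ℚ) →ₗ[ℚ] (G →₀ ℚ) :=
  Finsupp.linearCombination ℚ fun p ↦ Finsupp.single p.2 1 - Finsupp.single p.1 1

@[simp]
lemma barBoundary_single {G : Type*} (p : G × G) (r : ℚ) :
    barBoundary G (Finsupp.single p r) = Finsupp.single p.2 r - Finsupp.single p.1 r := by
  simp [barBoundary, smul_sub]

lemma barBoundary_permRep {G : Type*} [Group G] (g : G) (f : G × G →₀ ℚ) :
    barBoundary G (permRep G (G × G) g f) = permRep G G g (barBoundary G f) := by
  induction f using Finsupp.induction_linear with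
  | zero => simp
  | add f g hf hg => simp [hf, hg]
  | single p r => simp

lemma augmentation_barBoundary {G : Type*} (f : G × G →₀ ℚ) :
    Finsupp.linearCombination ℚ (fun _ : G ↦ (1 : ℚ)) (barBoundary G f) = 0 := by
  induction f using Finsupp.induction_linear with
  | zero => simp
  | add f g hf hg => simp [hf, hg]
  | single p r => simp

/-- If `H²` vanishes, the derivation `g ↦ g - 1` lifts through the boundary map of the bar
resolution. -/
lemma exists_derivation_of_subsingleton_H2 {G : Type} [Group G]
    (hcd : ∀ M : Rep ℚ G, Subsingleton (groupCohomology M 2)) :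
    ∃ D : G → G × G →₀ ℚ, (∀ g h, D (g * h) = permRep G (G × G) g (D h) + D g) ∧
      ∀ g, barBoundary G (D g) = Finsupp.single g 1 - Finsupp.single 1 1 := by
  let σ := (permRep G (G × G)).subrepresentation (LinearMap.ker (barBoundary G)) fun g f hf ↦ by
    rw [Submodule.mem_comap, LinearMap.mem_ker, barBoundary_permRep, LinearMap.mem_ker.1 hf,
      map_zero]
  let e (g : G) : G × G →₀ ℚ := Finsupp.single (1, g) 1
  let c (p : G × G) : LinearMap.ker (barBoundary G) :=
    ⟨permRep G (G × G) p.1 (e p.2) - e (p.1 * p.2) + e p.1, by simp [e]⟩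
  obtain ⟨b, hb⟩ : ∃ b : G → LinearMap.ker (barBoundary G),
      ∀ g h, σ g (b h) - b (g * h) + b g = c (g, h) :=
    exists_of_subsingleton_H2 (hcd (Rep.of σ)) c fun g h j ↦ by
      apply Subtype.ext
      simp [c, e, σ, mul_assoc]
      abel
  refine ⟨fun g ↦ e g - (b g).1, fun g h ↦ ?_, fun g ↦ ?_⟩
  · have h1 : permRep G (G × G) g (b h).1 - (b (g * h)).1 + (b g).1 =
        permRep G (G × G) g (e h) - e (g * h) + e g := congrArg Subtype.val (hb g h)
    beta_reduce
    rw [map_sub, ← sub_eq_zero]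
    rw [← sub_eq_zero] at h1
    refine Eq.trans ?_ h1
    abel
  · rw [map_sub, LinearMap.mem_ker.1 (b g).2]
    simp [e]

theorem locally_virtually_cyclic_of_cd_le_one
    (G : Type) [Group G] [Countable G]
    (hlvc : ∀ H : Subgroup G, H.FG → IsVirtuallyCyclic H)
    (hnlf : ∃ H : Subgroup G, H.FG ∧ Infinite H)
    (hcd : ∀ k : ℕ, 2 ≤ k → ∀ M : Rep ℚ G, Subsingleton (groupCohomology M k)) :
    IsVirtuallyCyclic G := by
  obtain ⟨z, hz⟩ : ∃ z : G, ¬ IsOfFinOrder z := by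
    obtain ⟨H, hFG, hinf⟩ := hnlf
    obtain ⟨C, hC, hfin⟩ := hlvc H hFG
    obtain ⟨c, rfl⟩ := (Subgroup.isCyclic_iff_exists_zpowers_eq_top C).1 hC
    refine ⟨c, fun h ↦ ?_⟩
    have hcard := (Subgroup.zpowers c).card_mul_index
    rw [Nat.card_zpowers, Nat.card_eq_zero_of_infinite (α := H)] at hcard
    exact (mul_ne_zero (Submonoid.isOfFinOrder_coe.1 h).orderOf_pos.ne' hfin.index_ne_zero) hcard
  obtain ⟨D, hD, hDb⟩ := exists_derivation_of_subsingleton_H2 (hcd 2 le_rfl)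
  refine ⟨Subgroup.zpowers z, inferInstance,
    finiteIndex_zpowers_of_derivation hD hz (fun g ↦ ?_) fun f hf ↦ ?_⟩
  · have hFG : (Subgroup.closure {z, g}).FG := (Subgroup.fg_iff _).2 ⟨{z, g}, rfl, Set.toFinite _⟩
    let z' : Subgroup.closure {z, g} := ⟨z, Subgroup.subset_closure (by simp)⟩
    let g' : Subgroup.closure {z, g} := ⟨g, Subgroup.subset_closure (by simp)⟩
    obtain ⟨m, hm, ε, hε, h⟩ := (hlvc _ hFG).exists_conj_pow (z := z')
      (fun h ↦ hz (Submonoid.isOfFinOrder_coe.2 h)) g'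
    exact ⟨m, hm, ε, hε, congrArg Subtype.val h⟩
  · have hfix : permRep G G z (barBoundary G f - Finsupp.single 1 1) =
        barBoundary G f - Finsupp.single 1 1 := by
      have := congrArg (barBoundary G) hf
      rw [map_sub, barBoundary_permRep, hDb] at this
      rw [map_sub, permRep_single, smul_eq_mul, mul_one]
      rw [sub_eq_sub_iff_add_eq_add] at this ⊢
      rw [this, add_comm]
    have h := congrArg (Finsupp.linearCombination ℚ (fun _ : G ↦ (1 : ℚ)))
      (eq_zero_of_permRep_eq_self hz hfix)
    rw [map_sub, augmentation_barBoundary] at h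
    simp at h
end
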